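/- Let n > 1, k ≥ 3, and let g_1, …, g_n ∈ C_0^k(M^n, 𝔸) have compact support. Then the following are equivalent: (i) the system ∂̄_j f = g_j (j = 1, …, n) admits a solution f ∈ C^k(M^n, 𝔸) with compact support; (ii) for every j = 2, …, n and every x = (x_1, x^0) ∈ M^n, g_j(x) = −∂̄_j ( ∫_M E(y_1) g_1(y_1 + x_1, x^0) dV(y_1) ); (iii) ∂̄_i(∂_j g_j) = Δ_j g_i on M^n for all i, j = 1, …, n. Moreover, in case (i) the solution f vanishes on the unbounded connected component of M^n ∖ (supp g_1 ∪ ⋯ ∪ supp g_n). -/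

import Mathlib

open MeasureTheory

noncomputable section

/-- A real alternative `*`-algebra of finite dimension `> 1`, with a fixed
hypercomplex basis `v 0 = 1, v 1, …, v m` spanning the hypercomplex subspace `M`.
Multiplication is `ℝ`-bilinear (bundled as a linear map). -/
structure HCAlg (𝔸 : Type) [NormedAddCommGroup 𝔸] [NormedSpace ℝ 𝔸] (m : ℕ) : Type where
  mul : 𝔸 →ₗ[ℝ] 𝔸 →ₗ[ℝ] 𝔸
  one : 𝔸
  conj : 𝔸 →ₗ[ℝ] 𝔸
  findim : FiniteDimensional ℝ 𝔸
  dim_gt_one : 1 < Module.finrank ℝ 𝔸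
  one_mul' : ∀ a, mul one a = a
  mul_one' : ∀ a, mul a one = a
  alt_left : ∀ a b, mul a (mul a b) = mul (mul a a) b
  alt_right : ∀ a b, mul (mul b a) a = mul b (mul a a)
  conj_invol : ∀ a, conj (conj a) = a
  conj_mul' : ∀ a b, conj (mul a b) = mul (conj b) (conj a)
  conj_one : conj one = one
  hm : 1 ≤ m
  v : Fin (m + 1) → 𝔸
  v_indep : LinearIndependent ℝ v
  v_zero : v 0 = one
  v_trace : ∀ s, s ≠ 0 → v s + conj (v s) = 0
  v_norm : ∀ s, s ≠ 0 → mul (v s) (conj (v s)) = one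
  v_anticomm : ∀ s t, s ≠ 0 → t ≠ 0 → s ≠ t → mul (v s) (v t) = -(mul (v t) (v s))

variable {𝔸 : Type} [NormedAddCommGroup 𝔸] [NormedSpace ℝ 𝔸] {m n : ℕ}

/-- `M^n`, identified with `ℝ^{(m+1)n}` via the coordinates `x j s`. -/
abbrev Mn (n m : ℕ) := Fin n → Fin (m + 1) → ℝ

/-- Euclidean norm of a point of `M` (in coordinates). -/
def enormM (c : Fin (m + 1) → ℝ) : ℝ := Real.sqrt (∑ s, c s ^ 2)

/-- Euclidean norm of a point of `M^n` (in coordinates). -/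
def enormMn (x : Mn n m) : ℝ := Real.sqrt (∑ j, ∑ s, x j s ^ 2)

/-- Partial derivative `∂f/∂x_{j,s}` for functions on `M^n`. -/
def pd {E : Type} [NormedAddCommGroup E] [NormedSpace ℝ E]
    (f : Mn n m → E) (j : Fin n) (s : Fin (m + 1)) (x : Mn n m) : E :=
  fderiv ℝ f x (Pi.single j (Pi.single s 1))

/-- Partial derivative `∂f/∂x_s` for functions on `M`. -/
def pd1 {E : Type} [NormedAddCommGroup E] [NormedSpace ℝ E]
    (f : (Fin (m + 1) → ℝ) → E) (s : Fin (m + 1)) (x : Fin (m + 1) → ℝ) : E :=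
  fderiv ℝ f x (Pi.single s 1)

/-- The Dirac (Cauchy–Riemann) operator `∂̄_j = ∑_s v_s ∂/∂x_{j,s}`. -/
def dbar (H : HCAlg 𝔸 m) (f : Mn n m → 𝔸) (j : Fin n) (x : Mn n m) : 𝔸 :=
  ∑ s, H.mul (H.v s) (pd f j s x)

/-- The conjugated Dirac operator `∂_j = ∑_s v_s^c ∂/∂x_{j,s}`. -/
def dconj (H : HCAlg 𝔸 m) (f : Mn n m → 𝔸) (j : Fin n) (x : Mn n m) : 𝔸 :=
  ∑ s, H.mul (H.conj (H.v s)) (pd f j s x)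

/-- The Laplacian `Δ_j = ∑_s ∂²/∂x_{j,s}²` in the `j`-th block of variables. -/
def lap {E : Type} [NormedAddCommGroup E] [NormedSpace ℝ E]
    (f : Mn n m → E) (j : Fin n) (x : Mn n m) : E :=
  ∑ s, pd (pd f j s) j s x

/-- Surface area of the unit `(N-1)`-sphere in `ℝ^N`: `σ_N = 2 π^{N/2} / Γ(N/2)`. -/
def usigma (N : ℕ) : ℝ := 2 * Real.pi ^ ((N : ℝ) / 2) / Real.Gamma ((N : ℝ) / 2)

/-- Embedding of coordinates into the hypercomplex subspace `M ⊆ 𝔸`. -/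
def embM (H : HCAlg 𝔸 m) (c : Fin (m + 1) → ℝ) : 𝔸 := ∑ s, c s • H.v s

/-- The Cauchy kernel `E(x) = σ_{m+1}⁻¹ x^c / |x|^{m+1}` on `M`. -/
def CauchyE (H : HCAlg 𝔸 m) (c : Fin (m + 1) → ℝ) : 𝔸 :=
  (usigma (m + 1) * enormM c ^ (m + 1))⁻¹ • H.conj (embM H c)

/-- The Bochner–Martinelli kernel components `K_j(x) = σ_N⁻¹ x_j^c / |x|^N`, `N = (m+1)n`. -/
def Kker (H : HCAlg 𝔸 m) (n : ℕ) (j : Fin n) (x : Mn n m) : 𝔸 :=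
  (usigma ((m + 1) * n) * enormMn x ^ ((m + 1) * n))⁻¹ • H.conj (embM H (x j))

/-- `Tsol g (x) = −∫_M E(y₁ − x₁) (g(y₁, x⁰)) dV(y₁)`. -/
def Tsol (H : HCAlg 𝔸 m) (hn : 0 < n) (g : Mn n m → 𝔸) (x : Mn n m) : 𝔸 :=
  - ∫ y1 : Fin (m + 1) → ℝ,
      H.mul (CauchyE H (y1 - x ⟨0, hn⟩)) (g (Function.update x ⟨0, hn⟩ y1))

/-- `Fint g (x) = ∫_M E(y₁) (g(y₁ + x₁, x⁰)) dV(y₁)`. -/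
def Fint (H : HCAlg 𝔸 m) (hn : 0 < n) (g : Mn n m → 𝔸) (x : Mn n m) : 𝔸 :=
  ∫ y1 : Fin (m + 1) → ℝ,
      H.mul (CauchyE H y1) (g (Function.update x ⟨0, hn⟩ (y1 + x ⟨0, hn⟩)))

section SliceIntegral

open scoped Pointwise Convolution

variable {V W E : Type} [NormedAddCommGroup V] [NormedSpace ℝ V]
  [NormedAddCommGroup W] [NormedSpace ℝ W] [NormedAddCommGroup E]

section

variable {ι : V →L[ℝ] W} {φ : W → E}

lemma HasCompactSupport.comp_slice (hφ : HasCompactSupport φ)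
    (hι : Topology.IsClosedEmbedding ι) (x : W) :
    HasCompactSupport fun y ↦ φ (x + ι y) :=
  hφ.comp_isClosedEmbedding
    (g := fun y ↦ x + ι y) ((Homeomorph.addLeft x).isClosedEmbedding.comp hι)

lemma isCompact_preimage_closedBall_sub_tsupport [ProperSpace W]
    (hι : Topology.IsClosedEmbedding ι) (hc : HasCompactSupport φ) (x : W) :
    IsCompact (ι ⁻¹' (Metric.closedBall x 1 - tsupport φ)) := by
  refine hι.isCompact_preimage ?_
  rw [sub_eq_add_neg]
  exact (isCompact_closedBall x 1).add hc.isCompact.neg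

lemma slice_eq_zero_of_notMem {x p : W} {t : V} (hp : p ∈ Metric.ball x 1)
    (ht : t ∉ ι ⁻¹' (Metric.closedBall x 1 - tsupport φ)) : φ (p - ι t) = 0 := by
  by_contra h
  exact ht ⟨p, Metric.ball_subset_closedBall hp, p - ι t, subset_tsupport _ h, by simp⟩

end

variable [MeasurableSpace V] [NormedSpace ℝ E]

/-- Integral of `φ` over the affine slice `x + range ι`, weighted by the scalar kernel `κ`. -/
def sliceInt (μ : Measure V) (κ : V → ℝ) (ι : V →L[ℝ] W) (φ : W → E) (x : W) : E :=
  ∫ y, κ y • φ (x + ι y) ∂μ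

variable {μ : Measure V} {κ : V → ℝ} {ι : V →L[ℝ] W} {φ : W → E}

lemma sliceInt_eq_convolution (x : W) :
    sliceInt μ κ ι φ x
      = (κ ⋆[ContinuousLinearMap.lsmul ℝ ℝ, μ] fun t ↦ φ (x - ι t)) 0 := by
  simp [sliceInt, convolution]

variable [BorelSpace V]

lemma integrable_slice (hκ : LocallyIntegrable κ μ) (hι : Topology.IsClosedEmbedding ι)
    (hφ : Continuous φ) (hc : HasCompactSupport φ) (x : W) :
    Integrable (fun y ↦ κ y • φ (x + ι y)) μ :=
  hκ.integrable_smul_right_of_hasCompactSupport (by fun_prop) (hc.comp_slice hι x)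

variable [ProperSpace W]

lemma contDiff_sliceInt {k : ℕ∞} (hκ : LocallyIntegrable κ μ)
    (hι : Topology.IsClosedEmbedding ι) (hφ : ContDiff ℝ k φ) (hc : HasCompactSupport φ) :
    ContDiff ℝ k (sliceInt μ κ ι φ) := by
  rw [contDiff_iff_contDiffAt]
  intro x
  have h := contDiffOn_convolution_right_with_param_comp (μ := μ)
    (ContinuousLinearMap.lsmul ℝ ℝ : ℝ →L[ℝ] E →L[ℝ] E)
    (s := Metric.ball x 1) (v := fun _ ↦ (0 : V)) (contDiffOn_const (n := k))
    (g := fun p t ↦ φ (p - ι t)) Metric.isOpen_ball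
    (isCompact_preimage_closedBall_sub_tsupport hι hc x)
    (fun p t hp ht ↦ slice_eq_zero_of_notMem hp ht) hκ
    (by
      apply ContDiff.contDiffOn
      exact hφ.comp (contDiff_fst.sub (ι.contDiff.comp contDiff_snd)))
  have h' := h.contDiffAt (Metric.ball_mem_nhds x one_pos)
  exact h'.congr_of_eventuallyEq (Filter.Eventually.of_forall fun y ↦ sliceInt_eq_convolution y)

lemma fderiv_sliceInt (hκ : LocallyIntegrable κ μ)
    (hι : Topology.IsClosedEmbedding ι) (hφ : ContDiff ℝ 1 φ) (hc : HasCompactSupport φ)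
    (x w : W) :
    fderiv ℝ (sliceInt μ κ ι φ) x w = sliceInt μ κ ι (fun z ↦ fderiv ℝ φ z w) x := by
  have hg : ContDiff ℝ 1 (fun q : W × V ↦ φ (q.1 - ι q.2)) :=
    hφ.comp (contDiff_fst.sub (ι.contDiff.comp contDiff_snd))
  have h := hasFDerivAt_convolution_right_with_param (μ := μ)
    (ContinuousLinearMap.lsmul ℝ ℝ : ℝ →L[ℝ] E →L[ℝ] E)
    (s := Metric.ball x 1) (g := fun p t ↦ φ (p - ι t)) Metric.isOpen_ball
    (isCompact_preimage_closedBall_sub_tsupport hι hc x)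
    (fun p t hp ht ↦ slice_eq_zero_of_notMem hp ht) hκ hg.contDiffOn (x, 0)
    (Metric.mem_ball_self one_pos)
  have h2 := HasFDerivAt.comp (f := fun e : W ↦ (e, (0 : V))) x h (hasFDerivAt_prodMk_left x 0)
  have h3 : HasFDerivAt (sliceInt μ κ ι φ) _ x :=
    h2.congr_of_eventuallyEq (Filter.Eventually.of_forall fun y ↦ sliceInt_eq_convolution y)
  have hfd (t : V) : fderiv ℝ (fun q : W × V ↦ φ (q.1 - ι q.2)) (x, t)
      = (fderiv ℝ φ (x - ι t)).comp
        (ContinuousLinearMap.fst ℝ W V - ι.comp (ContinuousLinearMap.snd ℝ W V)) := by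
    refine HasFDerivAt.fderiv ?_
    refine HasFDerivAt.comp (x, t) ((hφ.differentiable one_ne_zero) _).hasFDerivAt ?_
    exact hasFDerivAt_fst.sub (ι.hasFDerivAt.comp _ hasFDerivAt_snd)
  have hd : Continuous fun t : V ↦ fderiv ℝ (fun q : W × V ↦ φ (q.1 - ι q.2)) (x, -t) :=
    (hg.continuous_fderiv one_ne_zero).comp (by fun_prop)
  rw [h3.fderiv]
  simp only [ContinuousLinearMap.comp_apply, ContinuousLinearMap.inl_apply, convolution]
  rw [ContinuousLinearMap.integral_apply]
  · simp only [sliceInt]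
    congr 1
    ext t
    have := hfd (-t)
    simp only [map_neg, sub_neg_eq_add] at this
    simp [ContinuousLinearMap.precompR, Function.HasUncurry.uncurry, this]
  · simp only [Function.HasUncurry.uncurry, id, zero_sub]
    have hcs : HasCompactSupport fun t : V ↦
        fderiv ℝ (fun q : W × V ↦ φ (q.1 - ι q.2)) (x, -t) := by
      have : (fun t : V ↦ fderiv ℝ (fun q : W × V ↦ φ (q.1 - ι q.2)) (x, -t)) = fun t ↦
          ((fderiv ℝ φ (x + ι t)).comp
        (ContinuousLinearMap.fst ℝ W V - ι.comp (ContinuousLinearMap.snd ℝ W V))) := by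
        ext1 t; rw [hfd]; simp
      rw [this]
      exact ((hc.fderiv (𝕜 := ℝ)).comp_slice hι x).comp_left
        (g := fun A : W →L[ℝ] E ↦ A.comp
          (ContinuousLinearMap.fst ℝ W V - ι.comp (ContinuousLinearMap.snd ℝ W V))) (by simp)
    exact (hκ.integrable_smul_right_of_hasCompactSupport hd hcs).congr
      (Filter.Eventually.of_forall fun t ↦ by
        ext <;> simp [ContinuousLinearMap.precompR])

end SliceIntegral

section Polar

variable {E F : Type*} [NormedAddCommGroup E] [NormedSpace ℝ E] [MeasurableSpace E] [BorelSpace E]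
  [FiniteDimensional ℝ E] [Nontrivial E] [NormedAddCommGroup F] [NormedSpace ℝ F]
  (μ : Measure E) [μ.IsAddHaarMeasure]

lemma integral_eq_integral_sphere_integral_Ioi {f : E → F} (hf : Integrable f μ) :
    ∫ x, f x ∂μ = ∫ ω : Metric.sphere (0 : E) 1, (∫ r in Set.Ioi (0 : ℝ),
      r ^ (Module.finrank ℝ E - 1) • f (r • (ω : E))) ∂μ.toSphere := by
  set d := Module.finrank ℝ E
  have hmp := μ.measurePreserving_homeomorphUnitSphereProd
  have hemb := (homeomorphUnitSphereProd E).measurableEmbedding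
  let g : Metric.sphere (0 : E) 1 × Set.Ioi (0 : ℝ) → F := fun p ↦ f ((p.2 : ℝ) • (p.1 : E))
  have hg (x : ({0}ᶜ : Set E)) : g (homeomorphUnitSphereProd E x) = f x := by
    have hx : ‖(x : E)‖ ≠ 0 := norm_ne_zero_iff.2 x.2
    simp [g, smul_smul, hx]
  have hInt : Integrable g (μ.toSphere.prod (.volumeIoiPow (d - 1))) := by
    rw [← hmp.integrable_comp_emb hemb]
    have h1 : IntegrableOn f {0}ᶜ μ := hf.integrableOn
    rw [integrableOn_iff_comap_subtypeVal (measurableSet_singleton _).compl] at h1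
    exact h1.congr (Filter.Eventually.of_forall fun x ↦ (hg x).symm)
  calc
    ∫ x, f x ∂μ = ∫ x : ({(0)}ᶜ : Set E), f x ∂(μ.comap (↑)) := by
      rw [integral_subtype_comap (measurableSet_singleton _).compl f, restrict_compl_singleton]
    _ = ∫ p, g p ∂μ.toSphere.prod (.volumeIoiPow (d - 1)) := by
      rw [← hmp.integral_comp hemb g]
      simp only [hg]
    _ = ∫ ω, ∫ r, g (ω, r) ∂.volumeIoiPow (d - 1) ∂μ.toSphere :=
      integral_prod _ hInt
    _ = _ := by
      congr 1
      ext ω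
      simp only [Measure.volumeIoiPow, ENNReal.ofReal, g]
      rw [integral_withDensity_eq_integral_smul
        (measurable_subtype_coe.pow_const _).real_toNNReal,
        integral_subtype_comap measurableSet_Ioi
          fun a ↦ Real.toNNReal (a ^ (d - 1)) • f (a • (ω : E)),
        setIntegral_congr_fun measurableSet_Ioi fun x hx ↦ ?_]
      rw [NNReal.smul_def, Real.coe_toNNReal _ (pow_nonneg hx.out.le _)]

/-- The radial derivative against the homogeneous kernel of critical degree. -/
lemma integral_norm_pow_inv_smul_fderiv_self [CompleteSpace F] {φ : E → F}
    (hφ : ContDiff ℝ 1 φ) (hc : HasCompactSupport φ)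
    (hInt : Integrable (fun z ↦ (‖z‖ ^ Module.finrank ℝ E)⁻¹ • fderiv ℝ φ z z) μ) :
    ∫ z, (‖z‖ ^ Module.finrank ℝ E)⁻¹ • fderiv ℝ φ z z ∂μ
      = -(μ.toSphere.real Set.univ • φ 0) := by
  rw [integral_eq_integral_sphere_integral_Ioi μ hInt]
  have hd : 0 < Module.finrank ℝ E := Module.finrank_pos
  have key (ω : Metric.sphere (0 : E) 1) : ∫ r in Set.Ioi (0 : ℝ),
      r ^ (Module.finrank ℝ E - 1) • (‖r • (ω : E)‖ ^ Module.finrank ℝ E)⁻¹ •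
        fderiv ℝ φ (r • (ω : E)) (r • (ω : E)) = - φ 0 := by
    have hω : ‖(ω : E)‖ = 1 := by simp
    have hω0 : (ω : E) ≠ 0 := norm_ne_zero_iff.1 (by simp [hω])
    have h1 : ContDiff ℝ 1 fun r : ℝ ↦ φ (r • (ω : E)) := by fun_prop
    have h2 : HasCompactSupport fun r : ℝ ↦ φ (r • (ω : E)) :=
      hc.comp_isClosedEmbedding (isClosedEmbedding_smul_left hω0)
    have h0 := h2.integral_Ioi_deriv_eq h1 0
    rw [zero_smul] at h0
    rw [← h0]
    refine setIntegral_congr_fun measurableSet_Ioi fun r hr ↦ ?_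
    have hr : (0 : ℝ) < r := hr
    have h3 : HasDerivAt (fun r : ℝ ↦ φ (r • (ω : E))) (fderiv ℝ φ (r • (ω : E)) (ω : E)) r := by
      have := ((hφ.differentiable one_ne_zero) (r • (ω : E))).hasFDerivAt.comp_hasDerivAt r
        ((hasDerivAt_id r).smul_const (ω : E))
      simpa [Function.comp_def] using this
    simp only [h3.deriv, map_smul, smul_smul, norm_smul, hω, Real.norm_eq_abs, abs_of_pos hr]
    obtain ⟨k, hk⟩ : ∃ k, Module.finrank ℝ E = k + 1 := ⟨_, (Nat.succ_pred_eq_of_pos hd).symm⟩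
    rw [hk]
    have : r ^ (k + 1 - 1) * (((r * 1) ^ (k + 1))⁻¹ * r) = 1 := by
      simp only [mul_one, Nat.add_sub_cancel]; field_simp; ring
    rw [this, one_smul]
  simp only [key, integral_const, smul_neg]

end Polar

section CauchyKernel

lemma abs_apply_le_enormM (c : Fin (m + 1) → ℝ) (s : Fin (m + 1)) : |c s| ≤ enormM c := by
  rw [← Real.sqrt_sq_eq_abs]
  exact Real.sqrt_le_sqrt (Finset.single_le_sum (f := fun s ↦ c s ^ 2)
    (fun _ _ ↦ sq_nonneg _) (Finset.mem_univ s))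

lemma norm_le_enormM (c : Fin (m + 1) → ℝ) : ‖c‖ ≤ enormM c :=
  (pi_norm_le_iff_of_nonneg (Real.sqrt_nonneg _)).2 fun s ↦ abs_apply_le_enormM c s

lemma enormM_eq_norm (z : EuclideanSpace ℝ (Fin (m + 1))) : enormM z.ofLp = ‖z‖ := by
  simp [enormM, EuclideanSpace.norm_eq]

lemma continuous_enormM : Continuous (enormM : (Fin (m + 1) → ℝ) → ℝ) := by
  unfold enormM; fun_prop

lemma usigma_pos (m : ℕ) : 0 < usigma (m + 1) := by
  have : 0 < Real.Gamma (((m + 1 : ℕ) : ℝ) / 2) := Real.Gamma_pos_of_pos (by positivity)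
  unfold usigma
  positivity

lemma toSphere_real_univ_euclideanSpace :
    (volume : Measure (EuclideanSpace ℝ (Fin (m + 1)))).toSphere.real Set.univ
      = usigma (m + 1) := by
  have h : ((m : ℝ) + 1) / 2 ≠ 0 := by positivity
  have hG : 0 < Real.Gamma (((m : ℝ) + 1) / 2) := Real.Gamma_pos_of_pos (by positivity)
  rw [Measure.toSphere_real_apply_univ, measureReal_def, EuclideanSpace.volume_ball]
  simp only [ENNReal.ofReal_one, one_pow, one_mul, finrank_euclideanSpace, Fintype.card_fin,
    usigma]
  rw [ENNReal.toReal_ofReal (by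
    have : 0 < Real.Gamma (((m + 1 : ℕ) : ℝ) / 2 + 1) := Real.Gamma_pos_of_pos (by positivity)
    positivity)]
  rw [Real.sqrt_eq_rpow, ← Real.rpow_natCast, ← Real.rpow_mul Real.pi_pos.le]
  push_cast
  rw [Real.Gamma_add_one h]
  have : (1 : ℝ) / 2 * ((m : ℝ) + 1) = ((m : ℝ) + 1) / 2 := by ring
  rw [this]
  field_simp

/-- The `s`-th coordinate of the (unconjugated) Cauchy kernel. -/
def cauchyKer (s : Fin (m + 1)) (c : Fin (m + 1) → ℝ) : ℝ :=
  (usigma (m + 1) * enormM c ^ (m + 1))⁻¹ * c s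

lemma measurable_cauchyKer (s : Fin (m + 1)) : Measurable (cauchyKer (m := m) s) := by
  have := (continuous_enormM (m := m)).measurable
  unfold cauchyKer; fun_prop

lemma abs_cauchyKer_le (s : Fin (m + 1)) (c : Fin (m + 1) → ℝ) :
    |cauchyKer s c| ≤ (usigma (m + 1))⁻¹ * (‖c‖ ^ m)⁻¹ := by
  have hσ := usigma_pos m
  rcases eq_or_ne c 0 with rfl | hc
  · simp only [cauchyKer, Pi.zero_apply, mul_zero, abs_zero]; positivity
  have h0 : 0 < ‖c‖ := norm_pos_iff.2 hc
  have h1 := norm_le_enormM c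
  have h2 : 0 < enormM c := h0.trans_le h1
  rw [cauchyKer, abs_mul, abs_of_pos (by positivity), mul_inv, mul_assoc]
  gcongr
  calc (enormM c ^ (m + 1))⁻¹ * |c s| ≤ (enormM c ^ (m + 1))⁻¹ * enormM c := by
        gcongr; exact abs_apply_le_enormM c s
    _ = (enormM c ^ m)⁻¹ := by field_simp; ring
    _ ≤ (‖c‖ ^ m)⁻¹ := by gcongr

lemma locallyIntegrable_cauchyKer (s : Fin (m + 1)) :
    LocallyIntegrable (cauchyKer (m := m) s) := by
  refine locallyIntegrable_of_norm_le_rpow (C := (usigma (m + 1))⁻¹) (α := m) (by simp) (by simp)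
    (Filter.Eventually.of_forall fun c ↦ ?_) (measurable_cauchyKer s).aestronglyMeasurable
  rw [Real.norm_eq_abs, Real.rpow_neg (norm_nonneg _), Real.rpow_natCast]
  exact abs_cauchyKer_le s c

variable {F : Type*} [NormedAddCommGroup F] [NormedSpace ℝ F]

lemma integrable_cauchyKer_smul (s : Fin (m + 1)) {φ : (Fin (m + 1) → ℝ) → F}
    (hφ : Continuous φ) (hc : HasCompactSupport φ) :
    Integrable fun y ↦ cauchyKer s y • φ y :=
  (locallyIntegrable_cauchyKer s).integrable_smul_right_of_hasCompactSupport hφ hc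

lemma ContinuousLinearMap.apply_eq_sum_smul_single {ι : Type*} [Fintype ι] [DecidableEq ι]
    (L : (ι → ℝ) →L[ℝ] F) (y : ι → ℝ) : L y = ∑ s, y s • L (Pi.single s 1) := by
  conv_lhs => rw [pi_eq_sum_univ' y, map_sum]
  simp [← map_smul, ← Pi.single_smul]

lemma continuous_fderiv_apply_const {E : Type*} [NormedAddCommGroup E] [NormedSpace ℝ E]
    {φ : E → F} (hφ : ContDiff ℝ 1 φ) (v : E) : Continuous fun y ↦ fderiv ℝ φ y v :=
  (hφ.continuous_fderiv one_ne_zero).clm_apply continuous_const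

lemma hasCompactSupport_fderiv_apply_const {E : Type*} [NormedAddCommGroup E] [NormedSpace ℝ E]
    {φ : E → F} (hc : HasCompactSupport φ) (v : E) :
    HasCompactSupport fun y ↦ fderiv ℝ φ y v :=
  (hc.fderiv (𝕜 := ℝ)).comp_left (g := fun L : E →L[ℝ] F ↦ L v) (by simp)

/-- The Cauchy kernel has divergence `δ₀`. -/
lemma sum_integral_cauchyKer_smul_fderiv [CompleteSpace F] {φ : (Fin (m + 1) → ℝ) → F}
    (hφ : ContDiff ℝ 1 φ) (hc : HasCompactSupport φ) :
    ∑ s, ∫ y, cauchyKer s y • fderiv ℝ φ y (Pi.single s 1) = - φ 0 := by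
  have hi (s : Fin (m + 1)) : Integrable fun y ↦ cauchyKer s y • fderiv ℝ φ y (Pi.single s 1) :=
    integrable_cauchyKer_smul s (continuous_fderiv_apply_const hφ _)
      (hasCompactSupport_fderiv_apply_const hc _)
  have hσ := usigma_pos m
  have hsum : (fun y ↦ ∑ s, cauchyKer s y • fderiv ℝ φ y (Pi.single s 1))
      = fun y ↦ (usigma (m + 1))⁻¹ • (enormM y ^ (m + 1))⁻¹ • fderiv ℝ φ y y := by
    ext y
    rw [(fderiv ℝ φ y).apply_eq_sum_smul_single y, Finset.smul_sum, Finset.smul_sum]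
    refine Finset.sum_congr rfl fun s _ ↦ ?_
    rw [cauchyKer, mul_inv, smul_smul, smul_smul, mul_assoc]
  have hInt := integrable_finsetSum Finset.univ fun s _ ↦ hi s
  rw [← integral_finsetSum _ fun s _ ↦ hi s]
  simp only [hsum] at hInt ⊢
  rw [integral_smul]
  replace hInt : Integrable fun y ↦ (enormM y ^ (m + 1))⁻¹ • fderiv ℝ φ y y :=
    (integrable_smul_iff (inv_ne_zero hσ.ne') _).1 hInt
  let e := PiLp.continuousLinearEquiv 2 ℝ fun _ : Fin (m + 1) ↦ ℝ
  have hvp := PiLp.volume_preserving_ofLp (Fin (m + 1))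
  have hemb : MeasurableEmbedding (WithLp.ofLp : EuclideanSpace ℝ (Fin (m + 1)) → _) :=
    (MeasurableEquiv.toLp 2 (Fin (m + 1) → ℝ)).symm.measurableEmbedding
  have hφe : ContDiff ℝ 1 (φ ∘ e) := hφ.comp e.contDiff
  have hce : HasCompactSupport (φ ∘ e) := hc.comp_homeomorph e.toHomeomorph
  have heq (z : EuclideanSpace ℝ (Fin (m + 1))) :
      (enormM z.ofLp ^ (m + 1))⁻¹ • fderiv ℝ φ z.ofLp z.ofLp
        = (‖z‖ ^ Module.finrank ℝ (EuclideanSpace ℝ (Fin (m + 1))))⁻¹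
          • fderiv ℝ (φ ∘ e) z z := by
    rw [e.comp_right_fderiv]
    rw [enormM_eq_norm, finrank_euclideanSpace, Fintype.card_fin]
    rfl
  rw [← hvp.integral_comp hemb]
  rw [← hvp.integrable_comp_emb hemb] at hInt
  simp only [Function.comp_def, heq] at hInt ⊢
  have := integral_norm_pow_inv_smul_fderiv_self volume hφe hce hInt
  simp only [Function.comp_def] at this
  rw [this, toSphere_real_univ_euclideanSpace, smul_neg, smul_smul, inv_mul_cancel₀ hσ.ne']
  simp [e]

end CauchyKernel

section CauchyKernelCurl

variable {F : Type*} [NormedAddCommGroup F] [NormedSpace ℝ F]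

/-- Smooth regularization of the Cauchy kernel. -/
def regCauchyKer (ε : ℝ) (s : Fin (m + 1)) (c : Fin (m + 1) → ℝ) : ℝ :=
  (usigma (m + 1))⁻¹ * (c s * (∑ r, c r ^ 2 + ε) ^ (-(((m + 1 : ℕ) : ℝ) / 2)))

lemma contDiff_regCauchyKer {ε : ℝ} (hε : 0 < ε) (s : Fin (m + 1)) :
    ContDiff ℝ 1 (regCauchyKer (m := m) ε s) := by
  have h (c : Fin (m + 1) → ℝ) : ∑ r, c r ^ 2 + ε ≠ 0 := by positivity
  have h1 : ContDiff ℝ 1 fun c : Fin (m + 1) → ℝ ↦ ∑ r, c r ^ 2 + ε := by fun_prop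
  have h2 : ContDiff ℝ 1 fun c : Fin (m + 1) → ℝ ↦ c s := by fun_prop
  exact contDiff_const.mul (h2.mul (h1.rpow_const_of_ne h))

lemma fderiv_regCauchyKer_comm {ε : ℝ} (hε : 0 < ε) (s t : Fin (m + 1))
    (c : Fin (m + 1) → ℝ) :
    fderiv ℝ (regCauchyKer ε s) c (Pi.single t 1)
      = fderiv ℝ (regCauchyKer ε t) c (Pi.single s 1) := by
  set p : ℝ := -(((m + 1 : ℕ) : ℝ) / 2)
  have h : ∑ r, c r ^ 2 + ε ≠ 0 := by positivity
  have hq : HasFDerivAt (fun c : Fin (m + 1) → ℝ ↦ ∑ r, c r ^ 2 + ε)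
      (∑ r, (2 * c r) • ContinuousLinearMap.proj (R := ℝ) (φ := fun _ : Fin (m + 1) ↦ ℝ) r) c := by
    refine (HasFDerivAt.fun_sum fun r _ ↦ ?_).add_const ε
    simpa using (hasFDerivAt_apply (𝕜 := ℝ) r c).pow 2
  have hk (s : Fin (m + 1)) := (((hasFDerivAt_apply (𝕜 := ℝ) s c).mul
    (hq.rpow_const (p := p) (Or.inl h))).const_mul (usigma (m + 1))⁻¹)
  have e (s : Fin (m + 1)) : fderiv ℝ (regCauchyKer ε s) c = _ := (hk s).fderiv
  rw [e, e]
  simp [Pi.single_apply, eq_comm (a := t)]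
  left
  ring

lemma abs_regCauchyKer_le {ε : ℝ} (hε : 0 < ε) (s : Fin (m + 1)) (c : Fin (m + 1) → ℝ) :
    |regCauchyKer ε s c| ≤ |cauchyKer s c| := by
  have hσ := usigma_pos m
  rcases eq_or_ne c 0 with rfl | hc
  · simp [regCauchyKer]
  have h0 : 0 < enormM c := (norm_pos_iff.2 hc).trans_le (norm_le_enormM c)
  have hq : 0 < ∑ r, c r ^ 2 := Real.sqrt_pos.1 h0
  have hpow : (enormM c ^ (m + 1))⁻¹ = (∑ r, c r ^ 2) ^ (-(((m + 1 : ℕ) : ℝ) / 2)) := by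
    rw [enormM, Real.sqrt_eq_rpow, ← Real.rpow_natCast, ← Real.rpow_mul hq.le, Real.rpow_neg hq.le]
    congr 2; ring
  rw [regCauchyKer, cauchyKer, mul_inv, hpow, mul_assoc, abs_mul, abs_mul, abs_mul,
    abs_mul, mul_comm |c s|, abs_of_pos (a := (∑ r, c r ^ 2) ^ _) (by positivity),
    abs_of_pos (a := (∑ r, c r ^ 2 + ε) ^ _) (by positivity)]
  gcongr ?_ * (?_ * ?_)
  exact Real.rpow_le_rpow_of_nonpos hq (by linarith) (by simp; positivity)

lemma tendsto_regCauchyKer (s : Fin (m + 1)) (c : Fin (m + 1) → ℝ) :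
    Filter.Tendsto (fun k : ℕ ↦ regCauchyKer (1 / ((k : ℝ) + 1)) s c) Filter.atTop
      (nhds (cauchyKer s c)) := by
  rcases eq_or_ne c 0 with rfl | hc
  · simp [regCauchyKer, cauchyKer]
  have h0 : 0 < enormM c := (norm_pos_iff.2 hc).trans_le (norm_le_enormM c)
  have hq : 0 < ∑ r, c r ^ 2 := Real.sqrt_pos.1 h0
  have hpow : (enormM c ^ (m + 1))⁻¹ = (∑ r, c r ^ 2 + 0) ^ (-(((m + 1 : ℕ) : ℝ) / 2)) := by
    rw [add_zero, enormM, Real.sqrt_eq_rpow, ← Real.rpow_natCast, ← Real.rpow_mul hq.le,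
      Real.rpow_neg hq.le]
    congr 2; ring
  rw [cauchyKer, mul_inv, hpow, mul_assoc, mul_comm _ (c s)]
  refine Filter.Tendsto.const_mul _ (Filter.Tendsto.const_mul _ ?_)
  refine Filter.Tendsto.rpow_const ?_ (Or.inl (by simpa using hq.ne'))
  exact tendsto_one_div_add_atTop_nhds_zero_nat.const_add _

/-- The Cauchy kernel is curl free. -/
lemma integral_cauchyKer_smul_fderiv_comm {φ : (Fin (m + 1) → ℝ) → F}
    (hφ : ContDiff ℝ 1 φ) (hc : HasCompactSupport φ) (s t : Fin (m + 1)) :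
    ∫ y, cauchyKer s y • fderiv ℝ φ y (Pi.single t 1)
      = ∫ y, cauchyKer t y • fderiv ℝ φ y (Pi.single s 1) := by
  have hreg {ε : ℝ} (hε : 0 < ε) (s t : Fin (m + 1)) :
      ∫ y, regCauchyKer ε s y • fderiv ℝ φ y (Pi.single t 1)
        = - ∫ y, fderiv ℝ (regCauchyKer ε s) y (Pi.single t 1) • φ y := by
    have hk := contDiff_regCauchyKer hε s
    refine integral_smul_fderiv_eq_neg_fderiv_smul_of_integrable ?_ ?_ ?_
      (fun x _ ↦ hk.differentiable one_ne_zero x) (fun x _ ↦ hφ.differentiable one_ne_zero x)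
    · exact ((continuous_fderiv_apply_const hk _).smul
        hφ.continuous).integrable_of_hasCompactSupport
        hc.smul_left
    · exact (hk.continuous.smul
        (continuous_fderiv_apply_const hφ _)).integrable_of_hasCompactSupport
        (hasCompactSupport_fderiv_apply_const hc _).smul_left
    · exact (hk.continuous.smul hφ.continuous).integrable_of_hasCompactSupport hc.smul_left
  have hlim (s t : Fin (m + 1)) : Filter.Tendsto
      (fun k : ℕ ↦ ∫ y, regCauchyKer (1 / ((k : ℝ) + 1)) s y • fderiv ℝ φ y (Pi.single t 1))
      Filter.atTop (nhds (∫ y, cauchyKer s y • fderiv ℝ φ y (Pi.single t 1))) := by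
    have hd := continuous_fderiv_apply_const hφ (Pi.single t 1)
    have hInt := integrable_cauchyKer_smul s hd (hasCompactSupport_fderiv_apply_const hc _)
    refine tendsto_integral_of_dominated_convergence
      (fun y ↦ ‖cauchyKer s y • fderiv ℝ φ y (Pi.single t 1)‖) (fun k ↦ ?_) hInt.norm
      (fun k ↦ Filter.Eventually.of_forall fun y ↦ ?_)
      (Filter.Eventually.of_forall fun y ↦ (tendsto_regCauchyKer s y).smul_const _)
    · have := (contDiff_regCauchyKer (Nat.one_div_pos_of_nat (α := ℝ) (n := k)) s).continuous
      exact (this.smul hd).aestronglyMeasurable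
    · rw [norm_smul, norm_smul]
      gcongr
      exact abs_regCauchyKer_le Nat.one_div_pos_of_nat s y
  refine tendsto_nhds_unique (hlim s t) ((hlim t s).congr fun k ↦ ?_)
  have hε := Nat.one_div_pos_of_nat (α := ℝ) (n := k)
  rw [hreg hε, hreg hε]
  simp only [fderiv_regCauchyKer_comm hε s t]

end CauchyKernelCurl

namespace HCAlg

variable (H : HCAlg 𝔸 m)

lemma mul_mul_add_mul_mul (a b x : 𝔸) :
    H.mul a (H.mul b x) + H.mul b (H.mul a x) = H.mul (H.mul a b + H.mul b a) x := by
  have h := H.alt_left (a + b) x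
  simp only [map_add, LinearMap.add_apply, H.alt_left] at h ⊢
  have h' := sub_eq_zero.2 h
  rw [← sub_eq_zero, ← h']
  abel

lemma conj_v {s : Fin (m + 1)} (hs : s ≠ 0) : H.conj (H.v s) = -H.v s :=
  (neg_eq_of_add_eq_zero_right (H.v_trace s hs)).symm

lemma v_mul_v_self {s : Fin (m + 1)} (hs : s ≠ 0) : H.mul (H.v s) (H.v s) = -H.one := by
  rw [← H.v_norm s hs, H.conj_v hs, map_neg, neg_neg]

lemma conj_v_mul_v_mul (s t : Fin (m + 1)) (a : 𝔸) :
    H.mul (H.conj (H.v s)) (H.mul (H.v t) a) + H.mul (H.conj (H.v t)) (H.mul (H.v s) a)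
      = if s = t then (2 : ℝ) • a else 0 := by
  by_cases hs : s = 0 <;> by_cases ht : t = 0
  · subst hs ht
    simp [H.conj_one, H.v_zero, H.one_mul', two_smul]
  · subst hs
    simp [H.conj_one, H.v_zero, H.one_mul', H.conj_v ht, Ne.symm ht]
  · subst ht
    simp [H.conj_one, H.v_zero, H.one_mul', H.conj_v hs, hs]
  · rw [H.conj_v hs, H.conj_v ht]
    simp only [map_neg, LinearMap.neg_apply]
    rw [← neg_add, mul_mul_add_mul_mul]
    split_ifs with h
    · subst h
      simp [H.v_mul_v_self hs, H.one_mul', two_smul]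
    · simp [H.v_anticomm s t hs ht h]

lemma v_mul_conj_v_mul (s t : Fin (m + 1)) (a : 𝔸) :
    H.mul (H.v s) (H.mul (H.conj (H.v t)) a) + H.mul (H.v t) (H.mul (H.conj (H.v s)) a)
      = if s = t then (2 : ℝ) • a else 0 := by
  rw [← H.conj_v_mul_v_mul s t a]
  by_cases hs : s = 0 <;> by_cases ht : t = 0
  · subst hs ht
    simp [H.conj_one, H.v_zero, H.one_mul']
  · subst hs
    simp [H.conj_one, H.v_zero, H.one_mul', H.conj_v ht]
  · subst ht
    simp [H.conj_one, H.v_zero, H.one_mul', H.conj_v hs]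
  · rw [H.conj_v hs, H.conj_v ht]
    simp

lemma sum_sum_eq_of_add_swap {A : Fin (m + 1) → Fin (m + 1) → 𝔸}
    {B : Fin (m + 1) → Fin (m + 1) → 𝔸}
    (h : ∀ s t, B s t + B t s = if s = t then (2 : ℝ) • A s t else 0) :
    ∑ s, ∑ t, B s t = ∑ s, A s s := by
  have h2 : (2 : ℝ) • ∑ s, ∑ t, B s t = (2 : ℝ) • ∑ s, A s s := by
    rw [two_smul]
    nth_rw 2 [Finset.sum_comm]
    simp only [← Finset.sum_add_distrib, h]
    simp [Finset.smul_sum]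
  exact smul_right_injective 𝔸 two_ne_zero h2

lemma sum_conj_v_mul_sum_v_mul {A : Fin (m + 1) → Fin (m + 1) → 𝔸}
    (hA : ∀ s t, A s t = A t s) :
    ∑ s, H.mul (H.conj (H.v s)) (∑ t, H.mul (H.v t) (A s t)) = ∑ s, A s s := by
  simp only [map_sum]
  refine sum_sum_eq_of_add_swap fun s t ↦ ?_
  rw [hA t s, H.conj_v_mul_v_mul]

lemma sum_v_mul_sum_conj_v_mul {A : Fin (m + 1) → Fin (m + 1) → 𝔸}
    (hA : ∀ s t, A s t = A t s) :
    ∑ s, H.mul (H.v s) (∑ t, H.mul (H.conj (H.v t)) (A s t)) = ∑ s, A s s := by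
  simp only [map_sum]
  refine sum_sum_eq_of_add_swap fun s t ↦ ?_
  rw [hA t s, H.v_mul_conj_v_mul]

/-- Left multiplication as a continuous linear map. -/
def mulL (a : 𝔸) : 𝔸 →L[ℝ] 𝔸 :=
  letI := H.findim
  (H.mul a).toContinuousLinearMap

lemma mulL_apply (a b : 𝔸) : H.mulL a b = H.mul a b := rfl

lemma completeSpace (H : HCAlg 𝔸 m) : CompleteSpace 𝔸 :=
  haveI := H.findim
  FiniteDimensional.complete ℝ 𝔸

/-- **Cauchy–Pompeiu formula** for compactly supported functions on `M`. -/
lemma cauchyPompeiu {ψ : (Fin (m + 1) → ℝ) → 𝔸}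
    (hψ : ContDiff ℝ 1 ψ) (hc : HasCompactSupport ψ) :
    ∑ s, H.mul (H.conj (H.v s)) (∫ y, cauchyKer s y •
      ∑ t, H.mul (H.v t) (fderiv ℝ ψ y (Pi.single t 1))) = - ψ 0 := by
  have := H.completeSpace
  have hi (s t : Fin (m + 1)) :
      Integrable fun y ↦ cauchyKer s y • fderiv ℝ ψ y (Pi.single t 1) :=
    integrable_cauchyKer_smul s (continuous_fderiv_apply_const hψ _)
      (hasCompactSupport_fderiv_apply_const hc _)
  rw [← sum_integral_cauchyKer_smul_fderiv hψ hc, ← H.sum_conj_v_mul_sum_v_mul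
    (A := fun s t ↦ ∫ y, cauchyKer s y • fderiv ℝ ψ y (Pi.single t 1))
    (integral_cauchyKer_smul_fderiv_comm hψ hc)]
  refine Finset.sum_congr rfl fun s _ ↦ ?_
  congr 1
  simp only [← H.mulL_apply, Finset.smul_sum, ← (H.mulL _).map_smul]
  rw [integral_finsetSum _ fun t _ ↦ (H.mulL (H.v t)).integrable_comp (hi s t)]
  simp only [ContinuousLinearMap.integral_comp_comm _ (hi s _)]

end HCAlg

section PartialDerivatives

variable {F G : Type} [NormedAddCommGroup F] [NormedSpace ℝ F]
  [NormedAddCommGroup G] [NormedSpace ℝ G] {f : Mn n m → F}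

lemma contDiff_pd {k : ℕ} (hf : ContDiff ℝ (k + 1) f) (j : Fin n) (s : Fin (m + 1)) :
    ContDiff ℝ k (pd f j s) :=
  (hf.fderiv_right le_rfl).clm_apply contDiff_const

lemma hasCompactSupport_pd (hc : HasCompactSupport f) (j : Fin n) (s : Fin (m + 1)) :
    HasCompactSupport (pd f j s) :=
  hasCompactSupport_fderiv_apply_const hc _

lemma pd_comm (hf : ContDiff ℝ 2 f) (i j : Fin n) (s t : Fin (m + 1)) (x : Mn n m) :
    pd (pd f i s) j t x = pd (pd f j t) i s x := by
  have hd : DifferentiableAt ℝ (fderiv ℝ f) x :=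
    ((hf.fderiv_right (m := 1) le_rfl).differentiable one_ne_zero) x
  have h (u w : Mn n m) :
      fderiv ℝ (fun y ↦ fderiv ℝ f y u) x w = fderiv ℝ (fderiv ℝ f) x w u := by
    rw [fderiv_clm_apply hd (differentiableAt_const u)]
    simp
  change fderiv ℝ (fun y ↦ fderiv ℝ f y _) x _ = fderiv ℝ (fun y ↦ fderiv ℝ f y _) x _
  rw [h, h]
  exact (hf.contDiffAt.isSymmSndFDerivAt (by simp)).eq _ _

lemma pd_clm_apply (L : F →L[ℝ] G) (hf : Differentiable ℝ f) (j : Fin n) (s : Fin (m + 1))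
    (x : Mn n m) : pd (fun y ↦ L (f y)) j s x = L (pd f j s x) := by
  unfold pd
  have h : HasFDerivAt (fun y ↦ L (f y)) (L.comp (fderiv ℝ f x)) x :=
    L.hasFDerivAt.comp x (hf x).hasFDerivAt
  rw [h.fderiv]
  rfl

lemma pd_sum {α : Type*} (A : Finset α) {f : α → Mn n m → F}
    (hf : ∀ a ∈ A, Differentiable ℝ (f a)) (j : Fin n) (s : Fin (m + 1)) (x : Mn n m) :
    pd (fun y ↦ ∑ a ∈ A, f a y) j s x = ∑ a ∈ A, pd (f a) j s x := by
  unfold pd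
  rw [fderiv_fun_sum fun a ha ↦ hf a ha x]
  simp

lemma pd_neg (j : Fin n) (s : Fin (m + 1)) (x : Mn n m) :
    pd (fun y ↦ -f y) j s x = -pd f j s x := by
  simp [pd, fderiv_fun_neg]

end PartialDerivatives

section CauchyTransform

variable {F G : Type} [NormedAddCommGroup F] [NormedSpace ℝ F]
  [NormedAddCommGroup G] [NormedSpace ℝ G]

/-- The inclusion of the `j`-th block of variables. -/
def blockIncl (j : Fin n) : (Fin (m + 1) → ℝ) →L[ℝ] Mn n m :=
  ContinuousLinearMap.single ℝ (fun _ : Fin n ↦ Fin (m + 1) → ℝ) j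

lemma blockIncl_apply (j : Fin n) (y : Fin (m + 1) → ℝ) :
    blockIncl j y = (Pi.single j y : Mn n m) := rfl

lemma isClosedEmbedding_blockIncl (j : Fin n) :
    Topology.IsClosedEmbedding (blockIncl (m := m) j) :=
  LinearMap.isClosedEmbedding_of_injective (f := (blockIncl (m := m) j).toLinearMap)
    (LinearMap.ker_eq_bot.2 fun _ _ h ↦
      Pi.single_injective (M := fun _ : Fin n ↦ Fin (m + 1) → ℝ) j h)

lemma update_eq_add_blockIncl (x : Mn n m) (j : Fin n) (y : Fin (m + 1) → ℝ) :
    Function.update x j (y + x j) = x + blockIncl j y := by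
  ext i s
  by_cases h : i = j
  · subst h; simp [blockIncl_apply, add_comm]
  · simp [blockIncl_apply, h]

lemma fderiv_slice {f : Mn n m → F} (hf : Differentiable ℝ f) (j : Fin n) (x : Mn n m)
    (y : Fin (m + 1) → ℝ) (t : Fin (m + 1)) :
    fderiv ℝ (fun y ↦ f (x + blockIncl j y)) y (Pi.single t 1)
      = pd f j t (x + blockIncl j y) := by
  have h : HasFDerivAt (fun y ↦ f (x + blockIncl j y)) _ y :=
    (hf (x + blockIncl j y)).hasFDerivAt.comp y ((blockIncl j).hasFDerivAt.const_add x)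
  rw [h.fderiv]
  rfl

lemma contDiff_slice {f : Mn n m → F} {k : WithTop ℕ∞} (hf : ContDiff ℝ k f) (j : Fin n)
    (x : Mn n m) : ContDiff ℝ k fun y ↦ f (x + blockIncl j y) :=
  hf.comp (contDiff_const.add (blockIncl j).contDiff)

/-- Component of the Cauchy transform in the `j`-th block of variables. -/
def cauchyInt (j : Fin n) (s : Fin (m + 1)) (φ : Mn n m → F) : Mn n m → F :=
  sliceInt volume (cauchyKer s) (blockIncl j) φ

variable {φ : Mn n m → F}

lemma integrable_cauchyInt (hφ : Continuous φ) (hc : HasCompactSupport φ) (j : Fin n)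
    (s : Fin (m + 1)) (x : Mn n m) :
    Integrable fun y ↦ cauchyKer s y • φ (x + blockIncl j y) :=
  integrable_slice (locallyIntegrable_cauchyKer s) (isClosedEmbedding_blockIncl j) hφ hc x

lemma contDiff_cauchyInt {k : ℕ} (hφ : ContDiff ℝ k φ) (hc : HasCompactSupport φ) (j : Fin n)
    (s : Fin (m + 1)) : ContDiff ℝ k (cauchyInt j s φ) :=
  contDiff_sliceInt (k := (k : ℕ∞)) (locallyIntegrable_cauchyKer s)
    (isClosedEmbedding_blockIncl j) hφ hc

lemma pd_cauchyInt (hφ : ContDiff ℝ 1 φ) (hc : HasCompactSupport φ) (i j : Fin n)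
    (s t : Fin (m + 1)) (x : Mn n m) :
    pd (cauchyInt j s φ) i t x = cauchyInt j s (pd φ i t) x :=
  fderiv_sliceInt (locallyIntegrable_cauchyKer s) (isClosedEmbedding_blockIncl j) hφ hc x _

lemma sum_cauchyInt_pd [CompleteSpace F] (hφ : ContDiff ℝ 1 φ) (hc : HasCompactSupport φ)
    (j : Fin n) (x : Mn n m) : ∑ s, cauchyInt j s (pd φ j s) x = -φ x := by
  have h := sum_integral_cauchyKer_smul_fderiv (contDiff_slice hφ j x)
    (hc.comp_slice (isClosedEmbedding_blockIncl j) x)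
  simpa [cauchyInt, sliceInt, fderiv_slice (hφ.differentiable one_ne_zero)] using h

lemma cauchyInt_pd_comm (hφ : ContDiff ℝ 1 φ) (hc : HasCompactSupport φ)
    (j : Fin n) (s t : Fin (m + 1)) (x : Mn n m) :
    cauchyInt j s (pd φ j t) x = cauchyInt j t (pd φ j s) x := by
  have h := integral_cauchyKer_smul_fderiv_comm (contDiff_slice hφ j x)
    (hc.comp_slice (isClosedEmbedding_blockIncl j) x) s t
  simpa only [cauchyInt, sliceInt, fderiv_slice (hφ.differentiable one_ne_zero)] using h

lemma cauchyInt_clm_apply [CompleteSpace F] [CompleteSpace G] (L : F →L[ℝ] G)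
    (hφ : Continuous φ) (hc : HasCompactSupport φ)
    (j : Fin n) (s : Fin (m + 1)) (x : Mn n m) :
    cauchyInt j s (fun y ↦ L (φ y)) x = L (cauchyInt j s φ x) := by
  simp only [cauchyInt, sliceInt, ← map_smul]
  exact L.integral_comp_comm (integrable_cauchyInt hφ hc j s x)

lemma cauchyInt_sum {α : Type*} (A : Finset α) {φ : α → Mn n m → F}
    (hφ : ∀ a, Continuous (φ a)) (hc : ∀ a, HasCompactSupport (φ a))
    (j : Fin n) (s : Fin (m + 1)) (x : Mn n m) :
    cauchyInt j s (fun y ↦ ∑ a ∈ A, φ a y) x = ∑ a ∈ A, cauchyInt j s (φ a) x := by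
  simp only [cauchyInt, sliceInt, Finset.smul_sum]
  exact integral_finsetSum _ fun a _ ↦ integrable_cauchyInt (hφ a) (hc a) j s x

end CauchyTransform

open Filter Topology in
lemma tendsto_cauchyInt_add_blockIncl {F : Type} [NormedAddCommGroup F] [NormedSpace ℝ F]
    (hm : 1 ≤ m) {φ : Mn n m → F} (hφ : Continuous φ) (hc : HasCompactSupport φ) (j : Fin n)
    (s : Fin (m + 1)) (x : Mn n m) :
    Tendsto (fun N : ℕ ↦ cauchyInt j s φ (x + blockIncl j fun _ ↦ (N : ℝ))) atTop (𝓝 0) := by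
  have hψc : HasCompactSupport fun y ↦ φ (x + blockIncl j y) :=
    hc.comp_slice (isClosedEmbedding_blockIncl j) x
  have hψ : Continuous fun y ↦ φ (x + blockIncl j y) :=
    hφ.comp (continuous_const.add (blockIncl j).continuous)
  obtain ⟨R, hR⟩ := hψc.isCompact.isBounded.subset_closedBall 0
  have hI : Integrable fun y ↦ ‖φ (x + blockIncl j y)‖ :=
    (hψ.integrable_of_hasCompactSupport hψc).norm
  have hlim : Tendsto (fun N : ℕ ↦ (usigma (m + 1))⁻¹ * ((N : ℝ) + -R)⁻¹ *
      ∫ y, ‖φ (x + blockIncl j y)‖) atTop (𝓝 0) := by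
    have h := (tendsto_inv_atTop_zero.comp
      (tendsto_atTop_add_const_right atTop (-R) tendsto_natCast_atTop_atTop))
      |>.const_mul (usigma (m + 1))⁻¹ |>.mul_const (∫ y, ‖φ (x + blockIncl j y)‖)
    simpa using h
  refine squeeze_zero_norm' ?_ hlim
  filter_upwards [eventually_ge_atTop ⌈R + 1⌉₊] with N hN
  have hN : R + 1 ≤ N := Nat.ceil_le.1 hN
  have hshift : cauchyInt j s φ (x + blockIncl j fun _ ↦ (N : ℝ))
      = ∫ y, cauchyKer s (y - fun _ ↦ (N : ℝ)) • φ (x + blockIncl j y) := by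
    rw [← integral_add_right_eq_self _ fun _ : Fin (m + 1) ↦ (N : ℝ)]
    simp [cauchyInt, sliceInt, add_comm, add_left_comm]
  rw [hshift, ← integral_const_mul]
  refine norm_integral_le_of_norm_le (hI.const_mul _) (.of_forall fun y ↦ ?_)
  rw [norm_smul, Real.norm_eq_abs]
  by_cases hy : φ (x + blockIncl j y) = 0
  · simp [hy]
  refine mul_le_mul_of_nonneg_right ((abs_cauchyKer_le s _).trans ?_) (norm_nonneg _)
  have hyR : ‖y‖ ≤ R := by simpa using hR (subset_tsupport _ hy)
  have h1 : (N : ℝ) + -R ≤ ‖y - fun _ ↦ (N : ℝ)‖ := by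
    have h2 : ‖fun _ : Fin (m + 1) ↦ (N : ℝ)‖ = N := by simp
    have := norm_sub_norm_le (fun _ : Fin (m + 1) ↦ (N : ℝ)) y
    rw [norm_sub_rev, h2] at this
    linarith
  gcongr
  · exact inv_nonneg.2 (usigma_pos m).le
  · linarith
  · exact h1.trans (le_self_pow₀ (by linarith) (by omega))

namespace HCAlg

variable (H : HCAlg 𝔸 m)

/-- The Cauchy transform in the `j`-th block of variables. -/
def cauchyT (j : Fin n) (φ : Mn n m → 𝔸) (x : Mn n m) : 𝔸 :=
  ∑ s, H.mul (H.conj (H.v s)) (cauchyInt j s φ x)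

lemma cauchyE_eq (c : Fin (m + 1) → ℝ) :
    CauchyE H c = ∑ s, cauchyKer s c • H.conj (H.v s) := by
  simp [CauchyE, embM, cauchyKer, Finset.smul_sum, mul_smul]

variable {H} {φ ψ f : Mn n m → 𝔸}

lemma fint_eq_cauchyT (hn : 0 < n) (hφ : Continuous φ) (hc : HasCompactSupport φ) :
    Fint H hn φ = H.cauchyT ⟨0, hn⟩ φ := by
  have := H.completeSpace
  ext x
  have hi s := integrable_cauchyInt hφ hc ⟨0, hn⟩ s x
  simp only [Fint, cauchyT, update_eq_add_blockIncl, cauchyE_eq, map_sum, map_smul,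
    LinearMap.sum_apply, LinearMap.smul_apply, ← H.mulL_apply]
  simp only [← (H.mulL _).map_smul]
  rw [integral_finsetSum _ fun s _ ↦ (H.mulL _).integrable_comp (hi s)]
  exact Finset.sum_congr rfl fun s _ ↦ (H.mulL _).integral_comp_comm (hi s)

lemma contDiff_cauchyT {k : ℕ} (hφ : ContDiff ℝ k φ) (hc : HasCompactSupport φ) (j : Fin n) :
    ContDiff ℝ k (H.cauchyT j φ) :=
  ContDiff.sum fun s _ ↦ (H.mulL (H.conj (H.v s))).contDiff.comp (contDiff_cauchyInt hφ hc j s)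

lemma pd_sum_mul (a : Fin (m + 1) → 𝔸) {F : Fin (m + 1) → Mn n m → 𝔸}
    (hF : ∀ s, Differentiable ℝ (F s)) (j : Fin n) (t : Fin (m + 1)) (x : Mn n m) :
    pd (fun y ↦ ∑ s, H.mul (a s) (F s y)) j t x = ∑ s, H.mul (a s) (pd (F s) j t x) := by
  simp only [← H.mulL_apply]
  rw [pd_sum (f := fun s y ↦ H.mulL (a s) (F s y)) _ fun s _ ↦
    (H.mulL (a s)).differentiable.comp (hF s)]
  exact Finset.sum_congr rfl fun s _ ↦ pd_clm_apply _ (hF s) j t x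

lemma pd_cauchyT (hφ : ContDiff ℝ 1 φ) (hc : HasCompactSupport φ) (i j : Fin n)
    (t : Fin (m + 1)) (x : Mn n m) :
    pd (H.cauchyT j φ) i t x = H.cauchyT j (pd φ i t) x := by
  unfold cauchyT
  rw [pd_sum_mul _ fun s ↦
    (contDiff_cauchyInt (k := 1) hφ hc j s).differentiable one_ne_zero]
  simp only [pd_cauchyInt hφ hc]

lemma dbar_cauchyT_self (hφ : ContDiff ℝ 1 φ) (hc : HasCompactSupport φ) (j : Fin n)
    (x : Mn n m) : dbar H (H.cauchyT j φ) j x = -φ x := by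
  have := H.completeSpace
  simp only [dbar, pd_cauchyT hφ hc, cauchyT]
  rw [H.sum_v_mul_sum_conj_v_mul (A := fun t s ↦ cauchyInt j s (pd φ j t) x)
    fun s t ↦ cauchyInt_pd_comm hφ hc j t s x]
  exact sum_cauchyInt_pd hφ hc j x

lemma contDiff_dbar {k : ℕ} (hf : ContDiff ℝ (k + 1) f) (j : Fin n) :
    ContDiff ℝ k (dbar H f j) :=
  ContDiff.sum fun s _ ↦ (H.mulL (H.v s)).contDiff.comp (contDiff_pd hf j s)

lemma cauchyT_dbar (hf : ContDiff ℝ 1 f) (hc : HasCompactSupport f) (j : Fin n)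
    (x : Mn n m) : H.cauchyT j (dbar H f j) x = -f x := by
  have h := H.cauchyPompeiu (contDiff_slice hf j x)
    (hc.comp_slice (isClosedEmbedding_blockIncl j) x)
  simp only [fderiv_slice (hf.differentiable one_ne_zero), map_zero, add_zero] at h
  exact h

lemma dconj_dbar (hf : ContDiff ℝ 2 f) (j : Fin n) (x : Mn n m) :
    dconj H (dbar H f j) j x = lap f j x := by
  have hd t : Differentiable ℝ (pd f j t) :=
    (contDiff_pd (k := 1) hf j t).differentiable one_ne_zero
  unfold dconj dbar
  simp only [pd_sum_mul _ hd]
  exact H.sum_conj_v_mul_sum_v_mul fun s t ↦ pd_comm hf j j t s x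

lemma lap_dbar (hf : ContDiff ℝ 3 f) (i j : Fin n) (x : Mn n m) :
    dbar H (lap f j) i x = lap (dbar H f i) j x := by
  have h2 i s : ContDiff ℝ 2 (pd f i s) := contDiff_pd (k := 2) hf i s
  have h1 i s j t : ContDiff ℝ 1 (pd (pd f i s) j t) := contDiff_pd (k := 1) (h2 i s) j t
  have h0 s t : pd (pd (dbar H f i) j s) j t x
      = ∑ r, H.mul (H.v r) (pd (pd (pd f i r) j s) j t x) := by
    have : pd (dbar H f i) j s = fun y ↦ ∑ r, H.mul (H.v r) (pd (pd f i r) j s y) :=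
      funext fun y ↦ pd_sum_mul _ (fun r ↦ (h2 i r).differentiable two_ne_zero) j s y
    rw [this, pd_sum_mul _ fun r ↦ (h1 i r j s).differentiable one_ne_zero]
  have h3 r s : pd (pd (pd f i r) j s) j s x = pd (pd (pd f j s) j s) i r x := by
    rw [← pd_comm (h2 j s), show pd (pd f i r) j s = pd (pd f j s) i r from
      funext fun y ↦ pd_comm (hf.of_le (by norm_num)) i j r s y]
  simp only [lap, h0, h3]
  unfold dbar lap
  simp only [pd_sum _ fun s (_ : s ∈ Finset.univ) ↦ (h1 j s j s).differentiable one_ne_zero,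
    map_sum]
  exact Finset.sum_comm

lemma hasCompactSupport_sum_mul (a : Fin (m + 1) → 𝔸) {F : Fin (m + 1) → Mn n m → 𝔸}
    (hF : ∀ s, HasCompactSupport (F s)) : HasCompactSupport fun y ↦ ∑ s, H.mul (a s) (F s y) := by
  refine HasCompactSupport.of_support_subset_isCompact
    (isCompact_iUnion fun s ↦ (hF s).isCompact) fun y hy ↦ ?_
  obtain ⟨s, -, hs⟩ := Finset.exists_ne_zero_of_sum_ne_zero hy
  exact Set.mem_iUnion.2 ⟨s, subset_tsupport _ fun h ↦ hs (by simp [h])⟩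

lemma pd_dbar_cauchyT (hφ : ContDiff ℝ 2 φ) (hc : HasCompactSupport φ)
    (hψ : ContDiff ℝ 2 ψ) (hψc : HasCompactSupport ψ) {i j : Fin n}
    (h : ∀ x, dbar H (dconj H φ j) i x = lap ψ j x) (r : Fin (m + 1)) (x : Mn n m) :
    pd (dbar H (H.cauchyT j φ) i) j r x = -pd ψ j r x := by
  have := H.completeSpace
  have hφ1 i t : ContDiff ℝ 1 (pd φ i t) := contDiff_pd (k := 1) hφ i t
  have hψ1 i t : ContDiff ℝ 1 (pd ψ i t) := contDiff_pd (k := 1) hψ i t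
  have hc1 i t : HasCompactSupport (pd φ i t) := hasCompactSupport_pd hc i t
  have hψc1 i t : HasCompactSupport (pd ψ i t) := hasCompactSupport_pd hψc i t
  have hc2 i s j t : HasCompactSupport (pd (pd φ i s) j t) := hasCompactSupport_pd (hc1 i s) j t
  have h0 i s j t : Continuous (pd (pd φ i s) j t) :=
    (contDiff_pd (k := 0) (hφ1 i s) j t).continuous
  have hψ0 i s j t : Continuous (pd (pd ψ i s) j t) :=
    (contDiff_pd (k := 0) (hψ1 i s) j t).continuous
  have hL (a : Fin (m + 1) → 𝔸) (F : Fin (m + 1) → Mn n m → 𝔸) (hF : ∀ s, Continuous (F s))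
      (hFc : ∀ s, HasCompactSupport (F s)) :
      cauchyInt j r (fun y ↦ ∑ s, H.mul (a s) (F s y)) x
        = ∑ s, H.mul (a s) (cauchyInt j r (F s) x) := by
    simp only [← H.mulL_apply]
    rw [cauchyInt_sum (φ := fun s y ↦ H.mulL (a s) (F s y)) _
      (fun s ↦ (H.mulL (a s)).continuous.comp (hF s))
      fun s ↦ (hFc s).comp_left (map_zero (H.mulL (a s)))]
    exact Finset.sum_congr rfl fun s _ ↦ cauchyInt_clm_apply _ (hF s) (hFc s) j r x
  have hcont (a : Fin (m + 1) → 𝔸) (F : Fin (m + 1) → Mn n m → 𝔸) (hF : ∀ s, Continuous (F s)) :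
      Continuous fun y ↦ ∑ s, H.mul (a s) (F s y) :=
    continuous_finsetSum _ fun s _ ↦ (H.mulL (a s)).continuous.comp (hF s)
  have hT (t : Fin (m + 1)) : H.cauchyT j (pd (pd φ i t) j r) x
      = cauchyInt j r (fun y ↦ ∑ s, H.mul (H.conj (H.v s)) (pd (pd φ j s) i t y)) x := by
    rw [hL _ _ (fun s ↦ h0 j s i t) fun s ↦ hc2 j s i t]
    refine Finset.sum_congr rfl fun s _ ↦ ?_
    rw [cauchyInt_pd_comm (hφ1 i t) (hc1 i t), show pd (pd φ i t) j s = pd (pd φ j s) i t from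
      funext fun y ↦ pd_comm hφ i j t s y]
  calc pd (dbar H (H.cauchyT j φ) i) j r x
      = ∑ t, H.mul (H.v t) (H.cauchyT j (pd (pd φ i t) j r) x) := by
        have : dbar H (H.cauchyT j φ) i
            = fun y ↦ ∑ t, H.mul (H.v t) (H.cauchyT j (pd φ i t) y) :=
          funext fun y ↦ by simp only [dbar, pd_cauchyT (hφ.of_le one_le_two) hc]
        rw [this, pd_sum_mul _ fun t ↦
          (contDiff_cauchyT (k := 1) (hφ1 i t) (hc1 i t) j).differentiable one_ne_zero]
        simp only [pd_cauchyT (hφ1 i _) (hc1 i _)]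
    _ = cauchyInt j r (dbar H (dconj H φ j) i) x := by
        have : dbar H (dconj H φ j) i = fun y ↦ ∑ t, H.mul (H.v t)
            (∑ s, H.mul (H.conj (H.v s)) (pd (pd φ j s) i t y)) := by
          ext y
          unfold dbar dconj
          simp only [pd_sum_mul _ fun s ↦ (hφ1 j s).differentiable one_ne_zero]
        rw [this, hL _ _ (fun t ↦ hcont _ _ fun s ↦ h0 j s i t)
          fun t ↦ hasCompactSupport_sum_mul _ fun s ↦ hc2 j s i t]
        simp only [hT]
    _ = ∑ s, cauchyInt j r (pd (pd ψ j s) j s) x := by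
        rw [funext h, ← cauchyInt_sum _ (fun s ↦ hψ0 j s j s)
          fun s ↦ hasCompactSupport_pd (hψc1 j s) j s]
        rfl
    _ = ∑ s, cauchyInt j s (pd (pd ψ j r) j s) x := by
        refine Finset.sum_congr rfl fun s _ ↦ ?_
        rw [cauchyInt_pd_comm (hψ1 j s) (hψc1 j s), show pd (pd ψ j s) j r = pd (pd ψ j r) j s from
          funext fun y ↦ pd_comm hψ j j s r y]
    _ = -pd ψ j r x := sum_cauchyInt_pd (hψ1 j r) (hψc1 j r) j x

lemma apply_add_blockIncl_of_pd_eq_zero {F : Type} [NormedAddCommGroup F] [NormedSpace ℝ F]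
    {u : Mn n m → F} (hu : Differentiable ℝ u) {j : Fin n} (h : ∀ r x, pd u j r x = 0)
    (x : Mn n m) (y : Fin (m + 1) → ℝ) : u (x + blockIncl j y) = u x := by
  have hd : Differentiable ℝ fun y ↦ u (x + blockIncl j y) :=
    hu.comp ((differentiable_const x).add (blockIncl j).differentiable)
  have h0 (y : Fin (m + 1) → ℝ) : fderiv ℝ (fun y ↦ u (x + blockIncl j y)) y = 0 := by
    ext w
    rw [ContinuousLinearMap.apply_eq_sum_smul_single]
    simp [fderiv_slice hu, h]
  simpa using is_const_of_fderiv_eq_zero hd h0 y 0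

open Filter Topology in
lemma eq_neg_dbar_cauchyT (hφ : ContDiff ℝ 2 φ) (hc : HasCompactSupport φ)
    (hψ : ContDiff ℝ 2 ψ) (hψc : HasCompactSupport ψ) {i j : Fin n}
    (h : ∀ x, dbar H (dconj H φ j) i x = lap ψ j x) (x : Mn n m) :
    ψ x = -dbar H (H.cauchyT j φ) i x := by
  have hd : Differentiable ℝ (dbar H (H.cauchyT j φ) i) :=
    (contDiff_dbar (k := 1) (contDiff_cauchyT (k := 2) hφ hc j) i).differentiable one_ne_zero
  have hψd : Differentiable ℝ ψ := hψ.differentiable two_ne_zero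
  have hu : ∀ N : ℕ, dbar H (H.cauchyT j φ) i (x + blockIncl j fun _ ↦ (N : ℝ))
      + ψ (x + blockIncl j fun _ ↦ (N : ℝ)) = dbar H (H.cauchyT j φ) i x + ψ x := fun N ↦
    apply_add_blockIncl_of_pd_eq_zero (hd.add hψd) (fun r x ↦ by
      have := pd_dbar_cauchyT hφ hc hψ hψc h r x
      simp only [pd] at this ⊢
      rw [fderiv_add (hd x) (hψd x), add_apply, this, neg_add_cancel]) x _
  have h1 : Tendsto (fun N : ℕ ↦ dbar H (H.cauchyT j φ) i (x + blockIncl j fun _ ↦ (N : ℝ)))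
      atTop (𝓝 0) := by
    have key t s := tendsto_cauchyInt_add_blockIncl H.hm
      (contDiff_pd (k := 0) (hφ.of_le one_le_two) i t).continuous
      (hasCompactSupport_pd hc i t) j s x
    have key2 t : Tendsto (fun N : ℕ ↦ H.mul (H.v t)
        (H.cauchyT j (pd φ i t) (x + blockIncl j fun _ ↦ (N : ℝ)))) atTop (𝓝 0) := by
      have h2 : Tendsto (fun N : ℕ ↦ H.cauchyT j (pd φ i t) (x + blockIncl j fun _ ↦ (N : ℝ)))
          atTop (𝓝 0) := by
        simpa [cauchyT, H.mulL_apply] using tendsto_finsetSum Finset.univ fun s _ ↦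
          ((H.mulL (H.conj (H.v s))).continuous.tendsto' 0 0 (map_zero _)).comp (key t s)
      exact ((H.mulL (H.v t)).continuous.tendsto' 0 0 (map_zero _)).comp h2
    simpa [dbar, pd_cauchyT (hφ.of_le one_le_two) hc] using
      tendsto_finsetSum Finset.univ fun t _ ↦ key2 t
  have h2 : Tendsto (fun N : ℕ ↦ ψ (x + blockIncl j fun _ ↦ (N : ℝ))) atTop (𝓝 0) := by
    have h0 : Tendsto (fun y ↦ ψ (x + blockIncl j y)) (cocompact _) (𝓝 0) :=
      (hψc.comp_slice (isClosedEmbedding_blockIncl j) x).is_zero_at_infty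
    refine h0.comp (tendsto_norm_atTop_iff_cobounded.1 ?_ |>.mono_right
      Metric.cobounded_eq_cocompact.le)
    simpa using tendsto_natCast_atTop_atTop
  have h3 := h1.add h2
  simp only [hu, add_zero] at h3
  exact (neg_eq_of_add_eq_zero_right (tendsto_nhds_unique tendsto_const_nhds h3)).symm

end HCAlg

namespace HCAlg

variable {H : HCAlg 𝔸 m}

lemma cauchyT_eq_zero_of_forall {φ : Mn n m → 𝔸} {j : Fin n} {x : Mn n m}
    (h : ∀ y, φ (x + blockIncl j y) = 0) : H.cauchyT j φ x = 0 := by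
  simp [cauchyT, cauchyInt, sliceInt, h]

lemma hasCompactSupport_cauchyT {φ : Mn n m → 𝔸} {j i : Fin n} (hij : i ≠ j)
    (hφ : ContDiff ℝ 1 φ) (hc : HasCompactSupport φ)
    (hi : HasCompactSupport (dbar H (H.cauchyT j φ) i)) :
    HasCompactSupport (H.cauchyT j φ) := by
  obtain ⟨R, hR⟩ := (hc.isCompact.union hi.isCompact).isBounded.subset_closedBall 0
  have hzero {ψ : Mn n m → 𝔸} (hψ : tsupport ψ ⊆ Metric.closedBall 0 R) (x : Mn n m) (l : Fin n)
      (hx : R < ‖x l‖) : ψ x = 0 := by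
    by_contra h
    have := hψ (subset_tsupport _ h)
    rw [mem_closedBall_zero_iff] at this
    exact ((norm_le_pi_norm x l).trans this).not_gt hx
  have hφR := hzero (Set.subset_union_left.trans hR)
  have hiR := hzero (Set.subset_union_right.trans hR)
  have h1 {x : Mn n m} {l : Fin n} (hl : l ≠ j) (hx : R < ‖x l‖) : H.cauchyT j φ x = 0 :=
    cauchyT_eq_zero_of_forall fun y ↦ hφR _ l (by simpa [blockIncl_apply, hl] using hx)
  have h2 {x : Mn n m} (hx : R < ‖x j‖) : H.cauchyT j φ x = 0 := by
    have hT : ContDiff ℝ 1 (H.cauchyT j φ) := contDiff_cauchyT (k := 1) hφ hc j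
    have hcs : HasCompactSupport fun y ↦ H.cauchyT j φ (x + blockIncl i y) := by
      refine HasCompactSupport.of_support_subset_isCompact
        (isCompact_closedBall (0 : Fin (m + 1) → ℝ) (R + ‖x i‖)) fun y hy ↦ ?_
      rw [mem_closedBall_zero_iff]
      by_contra! hlt
      refine hy (h1 hij ?_)
      have := norm_sub_le (x i + y) (x i)
      rw [add_sub_cancel_left] at this
      simp only [Pi.add_apply, blockIncl_apply, Pi.single_eq_same]
      linarith
    have h := H.cauchyPompeiu (contDiff_slice hT i x) hcs
    have hd (y : Fin (m + 1) → ℝ) : dbar H (H.cauchyT j φ) i (x + blockIncl i y) = 0 :=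
      hiR _ j (by simpa [blockIncl_apply, hij.symm] using hx)
    unfold dbar at hd
    simpa [fderiv_slice (hT.differentiable one_ne_zero), hd] using h
  refine HasCompactSupport.of_support_subset_isCompact
    (isCompact_closedBall (0 : Mn n m) (max R 0)) fun x hx ↦ ?_
  rw [mem_closedBall_zero_iff, pi_norm_le_iff_of_nonneg (le_max_right _ _)]
  intro l
  by_contra! hlt
  have hl : R < ‖x l‖ := (le_max_left _ _).trans_lt hlt
  by_cases hj : l = j
  · exact hx (h2 (hj ▸ hl))
  · exact hx (h1 hj hl)

lemma dbar_neg (f : Mn n m → 𝔸) (j : Fin n) (x : Mn n m) :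
    dbar H (fun y ↦ -f y) j x = -dbar H f j x := by
  simp [dbar, pd_neg]

section System

variable {g : Fin n → Mn n m → 𝔸} {k : ℕ}

lemma eq_neg_dbar_cauchyT_of_dbar_eq {f : Mn n m → 𝔸} (hf : ContDiff ℝ 1 f)
    (hc : HasCompactSupport f) (h : ∀ j x, dbar H f j x = g j x) (i j : Fin n) (x : Mn n m) :
    g i x = -dbar H (H.cauchyT j (g j)) i x := by
  have hT : H.cauchyT j (g j) = fun y ↦ -f y := by
    rw [← funext (h j)]
    exact funext fun y ↦ cauchyT_dbar hf hc j y
  rw [hT, dbar_neg, neg_neg, h]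

lemma exists_dbar_eq_iff (hn : 1 < n) (hk : 1 ≤ k) (hg : ∀ j, ContDiff ℝ k (g j))
    (hgs : ∀ j, HasCompactSupport (g j)) (j : Fin n) :
    (∃ f : Mn n m → 𝔸, ContDiff ℝ k f ∧ HasCompactSupport f ∧ ∀ i x, dbar H f i x = g i x) ↔
      ∀ i, i ≠ j → ∀ x, g i x = -dbar H (H.cauchyT j (g j)) i x := by
  have hk1 : ((1 : ℕ) : WithTop ℕ∞) ≤ k := by exact_mod_cast hk
  refine ⟨fun ⟨f, hf, hc, h⟩ i _ x ↦
    eq_neg_dbar_cauchyT_of_dbar_eq (hf.of_le hk1) hc h i j x, fun h ↦ ?_⟩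
  have : Nontrivial (Fin n) := Fin.nontrivial_iff_two_le.2 hn
  obtain ⟨i, hi⟩ := exists_ne j
  have hci : HasCompactSupport (dbar H (H.cauchyT j (g j)) i) := by
    rw [show dbar H (H.cauchyT j (g j)) i = -g i from
      funext fun x ↦ by rw [Pi.neg_apply, h i hi x, neg_neg]]
    exact (hgs i).neg
  refine ⟨fun x ↦ -H.cauchyT j (g j) x, (contDiff_cauchyT (hg j) (hgs j) j).neg,
    (hasCompactSupport_cauchyT hi ((hg j).of_le hk1) (hgs j) hci).neg, fun l x ↦ ?_⟩
  rw [dbar_neg]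
  by_cases hl : l = j
  · rw [hl, dbar_cauchyT_self ((hg j).of_le hk1) (hgs j), neg_neg]
  · rw [← h l hl]

lemma dbar_dconj_of_dbar_eq {f : Mn n m → 𝔸} (hf : ContDiff ℝ 3 f)
    (h : ∀ j x, dbar H f j x = g j x) (i j : Fin n) (x : Mn n m) :
    dbar H (dconj H (g j) j) i x = lap (g i) j x := by
  rw [← funext (h j), ← funext (h i), ← lap_dbar hf]
  congr 1
  exact funext fun y ↦ dconj_dbar (hf.of_le (by norm_num)) j y

end System

end HCAlg

lemma differentiableOn_setIntegral {Y : Type*} [TopologicalSpace Y] [T2Space Y]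
    [SecondCountableTopology Y] [MeasurableSpace Y] [BorelSpace Y] {μ : Measure Y}
    [IsFiniteMeasureOnCompacts μ] {K : Set Y} (hK : IsCompact K) {U : Set ℂ} (hU : IsOpen U)
    {F F' : ℂ → Y → ℂ} (hF : ContinuousOn (Function.uncurry F) (U ×ˢ K))
    (hF' : ContinuousOn (Function.uncurry F') (U ×ˢ K))
    (hd : ∀ z ∈ U, ∀ y ∈ K, HasDerivAt (F · y) (F' z y) z) :
    DifferentiableOn ℂ (fun z ↦ ∫ y in K, F z y ∂μ) U := by
  intro z hz
  obtain ⟨ε, hε, hεU⟩ := Metric.nhds_basis_closedBall.mem_iff.1 (hU.mem_nhds hz)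
  obtain ⟨C, hC⟩ := ((isCompact_closedBall z ε).prod hK).exists_bound_of_continuousOn
    (hF'.mono (Set.prod_mono_left hεU))
  have hcont {F : ℂ → Y → ℂ} (hF : ContinuousOn (Function.uncurry F) (U ×ˢ K)) {z : ℂ}
      (hz : z ∈ U) : IntegrableOn (F z) K μ :=
    (hF.comp (f := fun y ↦ (z, y)) (by fun_prop) fun y hy ↦ ⟨hz, hy⟩).integrableOn_compact hK
  refine (hasDerivAt_integral_of_dominated_loc_of_deriv_le (F := F) (F' := F')
    (bound := fun _ ↦ C) (Metric.closedBall_mem_nhds z hε) ?_ (hcont hF hz)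
    (hcont hF' hz).aestronglyMeasurable ?_ ?_ ?_).2.differentiableAt.differentiableWithinAt
  · filter_upwards [hU.mem_nhds hz] with w hw using (hcont hF hw).aestronglyMeasurable
  · filter_upwards [ae_restrict_mem hK.measurableSet] with y hy w hw using hC (w, y) ⟨hw, hy⟩
  · exact integrableOn_const hK.measure_ne_top
  · filter_upwards [ae_restrict_mem hK.measurableSet] with y hy w hw using hd w (hεU hw) y hy

/-- Holomorphic extension of `cauchyKer`. -/
def cauchyKerC (s : Fin (m + 1)) (c : Fin (m + 1) → ℂ) : ℂ :=
  ((usigma (m + 1))⁻¹ : ℝ) * c s * (∑ i, c i ^ 2) ^ ((-((m + 1 : ℕ) / 2 : ℝ) : ℝ) : ℂ)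

lemma cauchyKerC_ofReal (s : Fin (m + 1)) (c : Fin (m + 1) → ℝ) :
    cauchyKerC s (fun i ↦ (c i : ℂ)) = cauchyKer s c := by
  have h0 : 0 ≤ ∑ i, c i ^ 2 := Finset.sum_nonneg fun i _ ↦ sq_nonneg _
  have h : (∑ i, c i ^ 2) ^ (-((m + 1 : ℕ) / 2 : ℝ)) = (enormM c ^ (m + 1))⁻¹ := by
    rw [Real.rpow_neg h0, enormM, Real.sqrt_eq_rpow, ← Real.rpow_natCast, ← Real.rpow_mul h0]
    congr 2
    ring
  rw [cauchyKerC, cauchyKer, mul_inv, ← h, Complex.ofReal_mul, Complex.ofReal_mul,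
    Complex.ofReal_cpow h0]
  push_cast
  ring

lemma contDiffOn_cauchyKerC (s : Fin (m + 1)) :
    ContDiffOn ℂ 1 (cauchyKerC s) {c | ∑ i, c i ^ 2 ∈ Complex.slitPlane} := by
  intro c hc
  refine ContDiffAt.contDiffWithinAt ?_
  have hQ : ContDiffAt ℂ 1 (fun c : Fin (m + 1) → ℂ ↦ ∑ i, c i ^ 2) c := by fun_prop
  have hlog : ContDiffAt ℂ 1 (fun c : Fin (m + 1) → ℂ ↦ Complex.log (∑ i, c i ^ 2)) c :=
    ContDiffAt.comp (g := Complex.log) c (Complex.contDiffAt_log hc) hQ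
  have hexp : ContDiffAt ℂ 1 (fun c : Fin (m + 1) → ℂ ↦ ((usigma (m + 1))⁻¹ : ℝ) * c s *
      Complex.exp (Complex.log (∑ i, c i ^ 2) * ((-((m + 1 : ℕ) / 2 : ℝ) : ℝ) : ℂ))) c := by
    fun_prop
  refine hexp.congr_of_eventuallyEq ?_
  filter_upwards [hQ.continuousAt.eventually_ne (Complex.slitPlane_ne_zero hc)] with b hb
  rw [cauchyKerC, Complex.cpow_def_of_ne_zero hb]

/-- Complexification of the segment from `p` in direction `w`, seen from `y`. -/
def complexLine (p w y : Fin (m + 1) → ℝ) (z : ℂ) : Fin (m + 1) → ℂ :=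
  fun i ↦ (y i - p i : ℝ) - z * w i

lemma hasDerivAt_complexLine (p w y : Fin (m + 1) → ℝ) (z : ℂ) :
    HasDerivAt (complexLine p w y) (fun i ↦ -(w i : ℂ)) z := by
  refine hasDerivAt_pi.2 fun i ↦ ?_
  simpa [complexLine] using ((hasDerivAt_id z).mul_const (w i : ℂ)).const_sub ((y i - p i : ℝ) : ℂ)

lemma complexLine_ofReal (p w y : Fin (m + 1) → ℝ) (t : ℝ) :
    complexLine p w y t = fun i ↦ (((y - (p + t • w)) i : ℝ) : ℂ) := by
  ext i
  simp [complexLine, sub_sub]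

lemma re_sum_complexLine_sq (p w y : Fin (m + 1) → ℝ) (z : ℂ) :
    (∑ i, complexLine p w y z i ^ 2).re
      = enormM (y - (p + z.re • w)) ^ 2 - (z.im * enormM w) ^ 2 := by
  have h (c : Fin (m + 1) → ℝ) : enormM c ^ 2 = ∑ i, c i ^ 2 :=
    Real.sq_sqrt (Finset.sum_nonneg fun i _ ↦ sq_nonneg _)
  rw [mul_pow, h, h, Finset.mul_sum, ← Finset.sum_sub_distrib, Complex.re_sum]
  refine Finset.sum_congr rfl fun i _ ↦ ?_
  simp [complexLine, pow_two]
  ring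

lemma differentiableOn_integral_cauchyKerC {γ : (Fin (m + 1) → ℝ) → ℝ} (hγ : Continuous γ)
    (hc : HasCompactSupport γ) (p w : Fin (m + 1) → ℝ) {U : Set ℂ} (hU : IsOpen U)
    (hUγ : ∀ z ∈ U, ∀ y ∈ tsupport γ, ∑ i, complexLine p w y z i ^ 2 ∈ Complex.slitPlane)
    (s : Fin (m + 1)) :
    DifferentiableOn ℂ (fun z ↦ ∫ y, cauchyKerC s (complexLine p w y z) * γ y) U := by
  have hΩ : IsOpen {c : Fin (m + 1) → ℂ | ∑ i, c i ^ 2 ∈ Complex.slitPlane} :=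
    Complex.isOpen_slitPlane.preimage (by fun_prop)
  have hmaps : Set.MapsTo (fun q : ℂ × (Fin (m + 1) → ℝ) ↦ complexLine p w q.2 q.1)
      (U ×ˢ tsupport γ) {c | ∑ i, c i ^ 2 ∈ Complex.slitPlane} :=
    fun q hq ↦ hUγ q.1 hq.1 q.2 hq.2
  have hline : Continuous fun q : ℂ × (Fin (m + 1) → ℝ) ↦ complexLine p w q.2 q.1 := by
    unfold complexLine
    fun_prop
  have hγ' : Continuous fun q : ℂ × (Fin (m + 1) → ℝ) ↦ (γ q.2 : ℂ) := by fun_prop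
  have hk := contDiffOn_cauchyKerC (m := m) s
  have h := differentiableOn_setIntegral (μ := volume) hc.isCompact hU
    (F := fun z y ↦ cauchyKerC s (complexLine p w y z) * γ y)
    (F' := fun z y ↦ fderiv ℂ (cauchyKerC s) (complexLine p w y z) (fun i ↦ -(w i : ℂ)) * γ y)
    ((hk.continuousOn.comp hline.continuousOn hmaps).mul hγ'.continuousOn)
    ((((hk.continuousOn_fderiv_of_isOpen hΩ le_rfl).comp hline.continuousOn hmaps).clm_apply
      continuousOn_const).mul hγ'.continuousOn)
    fun z hz y hy ↦ ((((hk.contDiffAt (hΩ.mem_nhds (hUγ z hz y hy))).differentiableAt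
      one_ne_zero).hasFDerivAt.comp_hasDerivAt z (hasDerivAt_complexLine p w y z)).mul_const _)
  refine h.congr fun z _ ↦ (setIntegral_eq_integral_of_forall_compl_eq_zero fun y hy ↦ ?_).symm
  simp [image_eq_zero_of_notMem_tsupport hy]

open Filter Topology in
lemma sum_integral_cauchyKer_eq_zero {γ : Fin (m + 1) → (Fin (m + 1) → ℝ) → ℝ}
    (hγ : ∀ s, Continuous (γ s)) (hγc : ∀ s, HasCompactSupport (γ s))
    {a p x : Fin (m + 1) → ℝ} {ρ₁ ρ₂ : ℝ} (hρ : ρ₁ < ρ₂)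
    (hγs : ∀ s, tsupport (γ s) ⊆ (Metric.ball a ρ₂)ᶜ) (hp : p ∈ Metric.ball a ρ₁)
    (hzero : ∀ᶠ q in 𝓝 p, ∑ s, ∫ y, cauchyKer s (y - q) * γ s y = 0)
    (hx : x ∈ Metric.ball a ρ₁) : ∑ s, ∫ y, cauchyKer s (y - x) * γ s y = 0 := by
  obtain ⟨w, rfl⟩ : ∃ w, x = p + w := ⟨x - p, by simp⟩
  have hew : 0 ≤ enormM w := Real.sqrt_nonneg _
  set U : Set ℂ := {z | p + z.re • w ∈ Metric.ball a ρ₁ ∧ |z.im| * enormM w < ρ₂ - ρ₁} with hUdef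
  have hline : Continuous fun z : ℂ ↦ p + z.re • w := by fun_prop
  have him : Continuous fun z : ℂ ↦ |z.im| * enormM w := by fun_prop
  have hUo : IsOpen U :=
    (Metric.isOpen_ball.preimage hline).inter (isOpen_lt him continuous_const)
  have hUc : Convex ℝ U := by
    intro z hz u hu b c hb hc' hbc
    refine ⟨?_, ?_⟩
    · have := (convex_ball a ρ₁) hz.1 hu.1 hb hc' hbc
      convert this using 1
      ext i
      simp
      linear_combination (-p i) * hbc
    · have h1 : |(b • z + c • u).im| ≤ b * |z.im| + c * |u.im| := by
        simpa [abs_mul, abs_of_nonneg hb, abs_of_nonneg hc'] using abs_add_le (b * z.im) (c * u.im)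
      have h2 : b * (|z.im| * enormM w) + c * (|u.im| * enormM w) < ρ₂ - ρ₁ :=
        (convex_Iio (ρ₂ - ρ₁)) hz.2 hu.2 hb hc' hbc
      calc _ ≤ (b * |z.im| + c * |u.im|) * enormM w := mul_le_mul_of_nonneg_right h1 hew
        _ < _ := by linarith
  have hUs z (hz : z ∈ U) s y (hy : y ∈ tsupport (γ s)) :
      ∑ i, complexLine p w y z i ^ 2 ∈ Complex.slitPlane := by
    refine Or.inl ?_
    rw [re_sum_complexLine_sq, sub_pos]
    have h1 := hγs s hy
    have h2 := hz.1
    rw [Set.mem_compl_iff, Metric.mem_ball, not_lt] at h1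
    rw [Metric.mem_ball] at h2
    have h3 : ρ₂ - ρ₁ ≤ ‖y - (p + z.re • w)‖ := by
      rw [← dist_eq_norm]
      linarith [dist_triangle y (p + z.re • w) a]
    rw [← sq_abs, abs_mul, abs_of_nonneg hew]
    exact pow_lt_pow_left₀ (hz.2.trans_le (h3.trans (norm_le_enormM _))) (by positivity) two_ne_zero
  set Φ : ℂ → ℂ := fun z ↦ ∑ s, ∫ y, cauchyKerC s (complexLine p w y z) * γ s y with hΦ
  have hΦd : AnalyticOnNhd ℂ Φ U := by
    refine DifferentiableOn.analyticOnNhd ?_ hUo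
    exact DifferentiableOn.fun_sum fun s _ ↦ differentiableOn_integral_cauchyKerC (hγ s) (hγc s) p w
      hUo (fun z hz y hy ↦ hUs z hz s y hy) s
  have hΦr (t : ℝ) : Φ t = (∑ s, ∫ y, cauchyKer s (y - (p + t • w)) * γ s y : ℝ) := by
    rw [hΦ, Complex.ofReal_sum]
    simp only [complexLine_ofReal, cauchyKerC_ofReal, ← integral_complex_ofReal,
      Complex.ofReal_mul]
  have h0 : (0 : ℂ) ∈ U := by simpa [hUdef, hρ] using hp
  have h1 : (1 : ℂ) ∈ U := by simpa [hUdef, hρ] using hx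
  have hfreq : ∃ᶠ z in 𝓝[≠] (0 : ℂ), Φ z = 0 := by
    have ht : Tendsto (fun t : ℝ ↦ (t : ℂ)) (𝓝[≠] 0) (𝓝[≠] 0) :=
      tendsto_nhdsWithin_of_tendsto_nhds_of_eventually_within _
        ((Complex.continuous_ofReal.tendsto' 0 0 Complex.ofReal_zero).mono_left
          nhdsWithin_le_nhds)
        (eventually_nhdsWithin_of_forall fun t ht ↦ Complex.ofReal_ne_zero.2 ht)
    refine ht.frequently (Eventually.frequently (eventually_nhdsWithin_of_eventually_nhds ?_))
    have hl : Tendsto (fun t : ℝ ↦ p + t • w) (𝓝 0) (𝓝 p) :=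
      Continuous.tendsto' (by fun_prop) _ _ (by simp)
    filter_upwards [hl.eventually hzero] with t ht
    rw [hΦr, ht, Complex.ofReal_zero]
  have hΦ1 : Φ 1 = 0 :=
    hΦd.eqOn_zero_of_preconnected_of_frequently_eq_zero hUc.isPreconnected h0 hfreq h1
  have h2 := hΦr 1
  rw [Complex.ofReal_one, hΦ1, one_smul] at h2
  exact Complex.ofReal_eq_zero.1 h2.symm

namespace HCAlg

variable (H : HCAlg 𝔸 m)

/-- The Dirac operator on `M`. -/
def dirac (ψ : (Fin (m + 1) → ℝ) → 𝔸) (y : Fin (m + 1) → ℝ) : 𝔸 :=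
  ∑ t, H.mul (H.v t) (fderiv ℝ ψ y (Pi.single t 1))

variable {H}

lemma continuous_dirac {ψ : (Fin (m + 1) → ℝ) → 𝔸} (hψ : ContDiff ℝ 1 ψ) :
    Continuous (H.dirac ψ) :=
  continuous_finsetSum _ fun t _ ↦ (H.mulL (H.v t)).continuous.comp
    (continuous_fderiv_apply_const hψ _)

lemma hasCompactSupport_dirac {ψ : (Fin (m + 1) → ℝ) → 𝔸} (hc : HasCompactSupport ψ) :
    HasCompactSupport (H.dirac ψ) :=
  (hc.fderiv ℝ).comp_left (g := fun A : (Fin (m + 1) → ℝ) →L[ℝ] 𝔸 ↦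
    ∑ t, H.mul (H.v t) (A (Pi.single t 1))) (by simp)

lemma clm_apply_eq_neg_sum_integral {ψ : (Fin (m + 1) → ℝ) → 𝔸} (hψ : ContDiff ℝ 1 ψ)
    (hc : HasCompactSupport ψ) (L : 𝔸 →L[ℝ] ℝ) (x : Fin (m + 1) → ℝ) :
    L (ψ x) = -∑ s, ∫ y, cauchyKer s (y - x) *
      L.comp (H.mulL (H.conj (H.v s))) (H.dirac ψ y) := by
  have := H.completeSpace
  have h := H.cauchyPompeiu (ψ := fun y ↦ ψ (x + y)) (hψ.comp (contDiff_const.add contDiff_id))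
    (hc.comp_homeomorph (Homeomorph.addLeft x))
  simp only [fderiv_comp_add_left, add_zero] at h
  rw [← neg_eq_iff_eq_neg] at h
  rw [← h, map_neg, map_sum]
  congr 1
  refine Finset.sum_congr rfl fun s _ ↦ ?_
  have hi := integrable_cauchyKer_smul s ((continuous_dirac (H := H) hψ).comp
    (continuous_const_add x)) ((hasCompactSupport_dirac hc).comp_homeomorph (Homeomorph.addLeft x))
  rw [← integral_add_left_eq_self (fun y ↦ cauchyKer s (y - x) * _) x]
  simp only [add_sub_cancel_left]
  refine ((L.comp (H.mulL (H.conj (H.v s)))).integral_comp_comm hi).symm.trans ?_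
  simp only [map_smul, smul_eq_mul, Function.comp_apply]

open Topology in
lemma eq_zero_of_dirac_eq_zero {ψ : (Fin (m + 1) → ℝ) → 𝔸} (hψ : ContDiff ℝ 1 ψ)
    (hc : HasCompactSupport ψ) {a p x : Fin (m + 1) → ℝ} {ρ₁ ρ₂ : ℝ} (hρ : ρ₁ < ρ₂)
    (hD : ∀ y ∈ Metric.ball a ρ₂, H.dirac ψ y = 0) (hp : p ∈ Metric.ball a ρ₁)
    (hψp : ψ =ᶠ[𝓝 p] 0) (hx : x ∈ Metric.ball a ρ₁) : ψ x = 0 := by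
  refine SeparatingDual.eq_zero_of_forall_dual_eq_zero (R := ℝ) fun L ↦ ?_
  have hrep := clm_apply_eq_neg_sum_integral (H := H) hψ hc L
  rw [hrep, neg_eq_zero]
  refine sum_integral_cauchyKer_eq_zero
    (γ := fun s y ↦ L.comp (H.mulL (H.conj (H.v s))) (H.dirac ψ y))
    (fun s ↦ (L.comp _).continuous.comp (continuous_dirac hψ))
    (fun s ↦ (hasCompactSupport_dirac hc).comp_left (map_zero (L.comp _))) hρ
    (fun s ↦ closure_minimal (fun y hy hyb ↦ hy ?_) Metric.isOpen_ball.isClosed_compl) hp ?_ hx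
  · simp only [hD y hyb, map_zero]
  · filter_upwards [hψp] with q hq
    rw [← neg_eq_zero, ← hrep, hq, Pi.zero_apply, map_zero]

end HCAlg

namespace HCAlg

variable {H : HCAlg 𝔸 m} {f : Mn n m → 𝔸}

open Topology in
lemma eq_zero_of_dbar_eq_zero (hf : ContDiff ℝ 1 f) (hc : HasCompactSupport f)
    {a p x : Mn n m} {ρ₁ ρ₂ : ℝ} (hρ : ρ₁ < ρ₂)
    (hD : ∀ j, ∀ y ∈ Metric.ball a ρ₂, dbar H f j y = 0) (hp : p ∈ Metric.ball a ρ₁)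
    (hfp : f =ᶠ[𝓝 p] 0) (hx : x ∈ Metric.ball a ρ₁) : f x = 0 := by
  have hρ₁ : 0 < ρ₁ := dist_nonneg.trans_lt hp
  have hpi {b q : Mn n m} {r : ℝ} (hr : 0 < r) :
      q ∈ Metric.ball b r ↔ ∀ j, dist (q j) (b j) < r := dist_pi_lt_iff hr
  simp only [hpi hρ₁, hpi (hρ₁.trans hρ)] at hD hp hx
  obtain ⟨ε, hε, hball⟩ := Metric.eventually_nhds_iff_ball.1 hfp
  simp only [hpi hε] at hball
  suffices key : ∀ A : Finset (Fin n), ∀ q : Mn n m, (∀ j, dist (q j) (a j) < ρ₁) →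
      (∀ j ∉ A, dist (q j) (p j) < ε) → f q = 0 from
    key Finset.univ x hx fun j hj ↦ (hj (Finset.mem_univ j)).elim
  intro A
  induction A using Finset.induction_on with
  | empty => exact fun q _ hq ↦ hball q fun j ↦ hq j (Finset.notMem_empty j)
  | insert i A _ ih =>
    intro q hqa hqp
    have hupd (y : Fin (m + 1) → ℝ) :
        Function.update q i 0 + blockIncl i y = Function.update q i y := by
      simpa using (update_eq_add_blockIncl (Function.update q i 0) i y).symm
    have hdist {b : Mn n m} {r : ℝ} {P : Fin n → Prop} (h : ∀ j, P j → j ≠ i → dist (q j) (b j) < r)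
        {y : Fin (m + 1) → ℝ} (hy : dist y (b i) < r) (j : Fin n) (hj : P j) :
        dist (Function.update q i y j) (b j) < r := by
      rcases eq_or_ne j i with rfl | hji
      · simpa using hy
      · simpa [hji] using h j hj hji
    have h0 : f (Function.update q i 0 + blockIncl i (q i)) = 0 := by
      refine eq_zero_of_dirac_eq_zero (H := H) (a := a i) (p := p i)
        (ψ := fun y ↦ f (Function.update q i 0 + blockIncl i y)) (contDiff_slice hf i _)
        (hc.comp_slice (isClosedEmbedding_blockIncl i) _) hρ (fun y hy ↦ ?_) (hp i) ?_ (hqa i)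
      · simp only [dirac, fderiv_slice (hf.differentiable one_ne_zero)]
        rw [hupd]
        exact hD i _ fun j ↦ hdist (P := fun _ ↦ True) (fun j _ _ ↦ (hqa j).trans hρ) hy j trivial
      · filter_upwards [Metric.ball_mem_nhds (p i) hε, Metric.isOpen_ball.mem_nhds (hp i)]
          with y hyp hya
        rw [hupd]
        refine ih _ (fun j ↦ hdist (P := fun _ ↦ True) (fun j _ _ ↦ hqa j) hya j trivial)
          (hdist (fun j hj hji ↦ hqp j ?_) hyp)
        simp [hj, hji]
    rwa [hupd, Function.update_eq_self] at h0

lemma eq_zero_of_not_isBounded_connectedComponentIn {g : Fin n → Mn n m → 𝔸}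
    (hf : ContDiff ℝ 1 f) (hc : HasCompactSupport f) (h : ∀ j x, dbar H f j x = g j x)
    {x : Mn n m} (hx : x ∈ (⋃ j, tsupport (g j))ᶜ)
    (hub : ¬ Bornology.IsBounded (connectedComponentIn ((⋃ j, tsupport (g j))ᶜ) x)) :
    f x = 0 := by
  have hopen : IsOpen (⋃ j, tsupport (g j))ᶜ :=
    (isClosed_iUnion_of_finite fun j ↦ isClosed_tsupport (g j)).isOpen_compl
  have hne : (connectedComponentIn (⋃ j, tsupport (g j))ᶜ x ∩ (tsupport f)ᶜ).Nonempty := by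
    rw [Set.inter_compl_nonempty_iff]
    exact fun hsub ↦ hub (hc.isCompact.isBounded.subset hsub)
  have hsub := isPreconnected_connectedComponentIn.subset_of_closure_inter_subset
    (isClosed_tsupport f).isOpen_compl hne fun q hq ↦ by
      obtain ⟨ρ, hρ, hball⟩ := Metric.isOpen_iff.1 hopen q (connectedComponentIn_subset _ _ hq.2)
      obtain ⟨p, hp, hqp⟩ := Metric.mem_closure_iff.1 hq.1 (ρ / 2) (half_pos hρ)
      rw [Set.mem_compl_iff, notMem_tsupport_iff_eventuallyEq] at hp ⊢
      filter_upwards [Metric.ball_mem_nhds q (half_pos hρ)] with y hy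
      refine eq_zero_of_dbar_eq_zero (H := H) hf hc (half_lt_self hρ) (fun j z hz ↦ ?_)
        (by rwa [Metric.mem_ball, dist_comm]) hp hy
      rw [h j z]
      exact image_eq_zero_of_notMem_tsupport fun hz' ↦ hball hz (Set.mem_iUnion.2 ⟨j, hz'⟩)
  exact image_eq_zero_of_notMem_tsupport (hsub (mem_connectedComponentIn hx))

end HCAlg

/-- **Theorem 5.2**: for compactly supported `g₁, …, g_n ∈ C₀^k(M^n, 𝔸)` (`n > 1`, `k ≥ 3`),
the following are equivalent:
(i) the system `∂̄_j f = g_j` has a compactly supported `C^k` solution;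
(ii) `g_j(x) = −∂̄_j (∫_M E(y₁) g₁(y₁ + x₁, x⁰) dV(y₁))` for `j = 2, …, n`;
(iii) `∂̄_i (∂_j g_j) = Δ_j g_i` for all `i, j`.
Moreover, in case (i) the solution vanishes on the unbounded connected component of
`M^n ∖ (supp g₁ ∪ ⋯ ∪ supp g_n)`. -/
theorem inhomogeneous_system_tfae (H : HCAlg 𝔸 m) (hn : 1 < n) (k : ℕ) (hk : 3 ≤ k)
    (g : Fin n → Mn n m → 𝔸)
    (hg : ∀ j, ContDiff ℝ k (g j)) (hgs : ∀ j, HasCompactSupport (g j)) :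
    ((∃ f : Mn n m → 𝔸, ContDiff ℝ k f ∧ HasCompactSupport f ∧
        ∀ (j : Fin n) (x : Mn n m), dbar H f j x = g j x) ↔
      (∀ j : Fin n, j ≠ ⟨0, by omega⟩ → ∀ x : Mn n m,
        g j x = - dbar H (Fint H (by omega) (g ⟨0, by omega⟩)) j x)) ∧
    ((∀ j : Fin n, j ≠ ⟨0, by omega⟩ → ∀ x : Mn n m,
        g j x = - dbar H (Fint H (by omega) (g ⟨0, by omega⟩)) j x) ↔
      (∀ (i j : Fin n) (x : Mn n m), dbar H (dconj H (g j) j) i x = lap (g i) j x)) ∧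
    (∀ f : Mn n m → 𝔸, ContDiff ℝ k f → HasCompactSupport f →
      (∀ (j : Fin n) (x : Mn n m), dbar H f j x = g j x) →
      ∀ x ∈ (⋃ j, tsupport (g j))ᶜ,
        ¬ Bornology.IsBounded (connectedComponentIn ((⋃ j, tsupport (g j))ᶜ) x) → f x = 0) := by
  have hk1 : (1 : WithTop ℕ∞) ≤ k := by exact_mod_cast (by omega : 1 ≤ k)
  have hk2 : (2 : WithTop ℕ∞) ≤ k := by exact_mod_cast (by omega : 2 ≤ k)
  have hk3 : (3 : WithTop ℕ∞) ≤ k := by exact_mod_cast hk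
  have hF := HCAlg.fint_eq_cauchyT (H := H) (Nat.zero_lt_of_lt hn)
    (hg ⟨0, Nat.zero_lt_of_lt hn⟩).continuous (hgs _)
  have hiff := HCAlg.exists_dbar_eq_iff (H := H) hn (by omega : 1 ≤ k) hg hgs
    ⟨0, Nat.zero_lt_of_lt hn⟩
  rw [hF]
  refine ⟨hiff, ⟨fun h2 ↦ ?_, fun h3 i _ x ↦ ?_⟩, fun f hf hc h x hx hub ↦ ?_⟩
  · obtain ⟨f, hf, -, h⟩ := hiff.2 h2
    exact HCAlg.dbar_dconj_of_dbar_eq (hf.of_le hk3) h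
  · exact HCAlg.eq_neg_dbar_cauchyT ((hg _).of_le hk2) (hgs _) ((hg i).of_le hk2) (hgs i)
      (h3 i _) x
  · exact HCAlg.eq_zero_of_not_isBounded_connectedComponentIn (hf.of_le hk1) hc h hx hub

end
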